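/- arXiv:1707.09544 — 2 statements merged into one kernel-verified Lean document; each statement's English description precedes it below -/
import Mathlib

section
/- The category EDig_srq, whose objects are finite reflexive digraphs with linear extensions and whose morphisms are strong rigid quotient maps, has the dual Ramsey property; and the category EPos_srq, whose objects are finite posets with linear extensions and whose morphisms are strong rigid quotient maps, has the dual Ramsey property. -/
open scoped Classical

noncomputable section

/-! ### Basic notions: anti-lexicographic order, types, matrices,
special anti-lexicographic order, rigid surjections -/

/-- `altLex X Y` : the anti-lexicographic order `⊏_alex` on subsets of a chain,
comparing characteristic vectors anti-lexicographically (`0 < 1`), i.e. the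
`⊏`-largest element on which `X` and `Y` differ belongs to `Y`. -/
def altLex {A : Type*} [LinearOrder A] (X Y : Finset A) : Prop :=
  ∃ m, m ∈ Y ∧ m ∉ X ∧ ∀ z, m < z → (z ∈ X ↔ z ∈ Y)

/-- The `≡_σ`-equivalence class of `i` within `{0, …, n-1}`, for a
(total quasi)order `σ` on `{0, …, n-1}`. -/
def classOf (σ : ℕ → ℕ → Prop) (n i : ℕ) : Finset ℕ :=
  (Finset.range n).filter fun j => σ i j ∧ σ j i

/-- The set of `≡_σ`-equivalence classes. -/
def classesOf (σ : ℕ → ℕ → Prop) (n : ℕ) : Finset (Finset ℕ) :=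
  (Finset.range n).image (classOf σ n)

/-- `σ ◁ τ` : the linear order on total quasiorders on `{0, …, n-1}` : `σ ◁ τ` if `σ`
has fewer classes, or they have equally many classes and the tuples of classes, each
listed in `<_alex`-increasing order, compare anti-lexicographically w.r.t. `<_alex`
(for such increasing enumerations of two families of sets this amounts to: the
`<_alex`-largest class in which the two families differ belongs to the family of
classes of `τ`). -/
def quasiLT (n : ℕ) (σ τ : ℕ → ℕ → Prop) : Prop :=
  (classesOf σ n).card < (classesOf τ n).card ∨
    ((classesOf σ n).card = (classesOf τ n).card ∧
      ∃ M, M ∈ classesOf τ n ∧ M ∉ classesOf σ n ∧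
        ∀ X, altLex M X → (X ∈ classesOf σ n ↔ X ∈ classesOf τ n))

/-- `IsTotalQuasiorder n σ` : `σ` is a total quasiorder on `{0, …, n-1}`. -/
def IsTotalQuasiorder (n : ℕ) (σ : ℕ → ℕ → Prop) : Prop :=
  (∀ i j, σ i j → i < n ∧ j < n) ∧ (∀ i < n, σ i i) ∧
    (∀ i j k, σ i j → σ j k → σ i k) ∧ ∀ i j, i < n → j < n → σ i j ∨ σ j i

/-- The type `tp(ā)` of a tuple (represented as a list): the total quasiorder
`{(i,j) : a_i ⊑ a_j}` on the set of positions of the list. -/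
def tpRel {A : Type*} [LinearOrder A] (l : List A) : ℕ → ℕ → Prop :=
  fun i j => ∃ (hi : i < l.length) (hj : j < l.length), l.get ⟨i, hi⟩ ≤ l.get ⟨j, hj⟩

/-- The special anti-lexicographic order `⊏_sal` on tuples (represented as lists):
`ā ⊏_sal b̄` iff `tp(ā) ◁ tp(b̄)`, or the types coincide, the sets of entries
differ and the set of entries of `ā` is `⊏_alex`-below that of `b̄`. -/
def salLT {A : Type*} [LinearOrder A] (l₁ l₂ : List A) : Prop :=
  l₁.length = l₂.length ∧
    (quasiLT l₁.length (tpRel l₁) (tpRel l₂) ∨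
      (tpRel l₁ = tpRel l₂ ∧ l₁.toFinset ≠ l₂.toFinset ∧ altLex l₁.toFinset l₂.toFinset))

/-- The matrix `mat(ā)` of a tuple: the `⊏`-increasing enumeration of its set of
entries (one representative from each `≡_{tp(ā)}`-class, in increasing order). -/
def matL {A : Type*} [LinearOrder A] (l : List A) : List A :=
  l.toFinset.sort (· ≤ ·)

/-- The number of `≡_σ`-classes strictly `≺_σ`-below the class of `i`. -/
def classRank (σ : ℕ → ℕ → Prop) (n i : ℕ) : ℕ :=
  (((Finset.range n).filter fun j => σ j i ∧ ¬ σ i j).image (classOf σ n)).card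

/-- `tup σ n b` : the `n`-tuple obtained by placing the `ξ`-th entry of `b` on all
coordinates belonging to the `ξ`-th `≡_σ`-class (classes enumerated in the
`≺_σ`-increasing order). -/
def tup {A : Type*} [Nonempty A] (σ : ℕ → ℕ → Prop) (n : ℕ) (b : List A) : List A :=
  (List.range n).map fun i => b.getD (classRank σ n i) (Classical.arbitrary A)

/-- `m` is the minimum of `S` with respect to a strict order `lt`. -/
def MinWrt {α : Type*} (lt : α → α → Prop) (S : Set α) (m : α) : Prop :=
  m ∈ S ∧ ∀ x ∈ S, x = m ∨ lt m x

/-- `f` maps `S` onto `T` and is rigid w.r.t. the strict orders `ltA`, `ltB`: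
minima of preimages of `ltB`-comparable elements are `ltA`-comparable in the
same order. -/
def IsRigidSurjOn {α β : Type*} (ltA : α → α → Prop) (ltB : β → β → Prop)
    (S : Set α) (T : Set β) (f : α → β) : Prop :=
  (∀ a ∈ S, f a ∈ T) ∧ (∀ b ∈ T, ∃ a ∈ S, f a = b) ∧
    ∀ x ∈ T, ∀ y ∈ T, ltB x y → ∀ a b, MinWrt ltA {u | u ∈ S ∧ f u = x} a →
      MinWrt ltA {u | u ∈ S ∧ f u = y} b → ltA a b

/-- A rigid surjection between chains: a surjection such that
`min f⁻¹(x) ⊏ min f⁻¹(y)` whenever `x ⊏' y`. -/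
def IsRigidSurjection {A B : Type*} [LinearOrder A] [LinearOrder B] (f : A → B) : Prop :=
  Function.Surjective f ∧ ∀ x y : B, x < y → ∀ a b : A,
    IsLeast {u | f u = x} a → IsLeast {v | f v = y} b → a < b

/-! ### The dual Ramsey property for a class of objects with
designated surjective morphisms.

`C ⟶ (B)^A_k` in `C^op` unfolds to: for every `k`-colouring `χ` of the
morphisms `C → A` there are `w : C → B` and a colour `i` such that
`χ(g ∘ w) = i` for every morphism `g : B → A`.  -/

/-- The dual Ramsey property for the (full) subcategory spanned by `S` of the category
whose objects are `Obj` and whose morphisms `X → Y` are the functions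
`carrier X → carrier Y` satisfying `IsMor X Y`. -/
def HasDualRamseySub {Obj : Type*} (carrier : Obj → Type*)
    (IsMor : ∀ X Y : Obj, (carrier X → carrier Y) → Prop) (S : Set Obj) : Prop :=
  ∀ k : ℕ, 2 ≤ k → ∀ A ∈ S, ∀ B ∈ S, (∃ f : carrier B → carrier A, IsMor B A f) →
    ∃ C ∈ S, ∀ χ : (carrier C → carrier A) → Fin k,
      ∃ w : carrier C → carrier B, IsMor C B w ∧ ∃ i : Fin k,
        ∀ g : carrier B → carrier A, IsMor B A g → χ (g ∘ w) = i

/-- The dual Ramsey property for the category whose objects are `Obj` and whose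
morphisms `X → Y` are the functions `carrier X → carrier Y` satisfying `IsMor X Y`. -/
def HasDualRamseyClass {Obj : Type*} (carrier : Obj → Type*)
    (IsMor : ∀ X Y : Obj, (carrier X → carrier Y) → Prop) : Prop :=
  HasDualRamseySub carrier IsMor Set.univ

end

noncomputable section

/-- A finite reflexive digraph with a linear extension. -/
structure EDigObj where
  carrier : Type
  [fintypeI : Fintype carrier]
  [linearOrderI : LinearOrder carrier]
  rel : carrier → carrier → Prop
  refl : ∀ x, rel x x
  ext : ∀ x y, rel x y → x ≠ y → x < y

attribute [instance] EDigObj.fintypeI EDigObj.linearOrderI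

/-- The binary relation of `M`, as a set of pairs represented by two-element lists. -/
def digPairs (M : EDigObj) : Set (List M.carrier) :=
  {l | ∃ x y, M.rel x y ∧ l = [x, y]}

/-- Strong rigid quotient maps: homomorphisms whose coordinatewise extension
`f̂ : (ρ,⊏_sal) → (ρ',⊏'_sal)` is a rigid surjection. The morphisms of `EDig_srq`. -/
def IsSRQdig (M N : EDigObj) (f : M.carrier → N.carrier) : Prop :=
  (∀ x y, M.rel x y → N.rel (f x) (f y)) ∧
    IsRigidSurjOn salLT salLT (digPairs M) (digPairs N) (List.map f)

/-- `RGWord c w d`: `w` is a restricted growth word started with `c` known letters `0, …, c-1`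
and finishing with `d` known letters; every letter is either known or the least unknown one. -/
def RGWord : ℕ → List ℕ → ℕ → Prop
  | c, [], d => c = d
  | c, a :: w, d => (a < c ∧ RGWord c w d) ∨ (a = c ∧ RGWord (c + 1) w d)

/-- Substitution of the word `g` for the parameters `t, t+1, …`; letters below `t` are fixed. -/
def plug (t : ℕ) (g : List ℕ) (a : ℕ) : ℕ :=
  if a < t then a else g.getD (a - t) 0

namespace RGWord

theorem le {w : List ℕ} : ∀ {c d : ℕ}, RGWord c w d → c ≤ d := by
  induction w with
  | nil => intro c d h; exact le_of_eq h
  | cons a w ih =>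
    rintro c d (⟨-, h⟩ | ⟨-, h⟩)
    · exact ih h
    · have := ih h; omega

theorem append_iff {u v : List ℕ} {c d : ℕ} :
    RGWord c (u ++ v) d ↔ ∃ e, RGWord c u e ∧ RGWord e v d := by
  induction u generalizing c with
  | nil => simp [RGWord]
  | cons a u ih =>
    simp only [List.cons_append, RGWord, ih]
    constructor
    · rintro (⟨h, e, h1, h2⟩ | ⟨h, e, h1, h2⟩)
      · exact ⟨e, Or.inl ⟨h, h1⟩, h2⟩
      · exact ⟨e, Or.inr ⟨h, h1⟩, h2⟩
    · rintro ⟨e, (⟨h, h1⟩ | ⟨h, h1⟩), h2⟩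
      · exact Or.inl ⟨h, e, h1, h2⟩
      · exact Or.inr ⟨h, e, h1, h2⟩

theorem lt_of_mem {w : List ℕ} {c d : ℕ} (h : RGWord c w d) : ∀ a ∈ w, a < d := by
  induction w generalizing c with
  | nil => simp
  | cons b w ih =>
    intro a ha
    rcases h with ⟨h1, h⟩ | ⟨h1, h⟩ <;> rcases List.mem_cons.1 ha with rfl | ha
    · exact h1.trans_le h.le
    · exact ih h a ha
    · have := h.le; omega
    · exact ih h a ha

theorem of_forall_lt {w : List ℕ} {c : ℕ} (h : ∀ a ∈ w, a < c) : RGWord c w c := by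
  induction w with
  | nil => rfl
  | cons b w ih =>
    exact Or.inl ⟨h b (by simp), ih fun a ha => h a (by simp [ha])⟩

theorem eq_of_forall_lt {w : List ℕ} {c d : ℕ} (h : ∀ a ∈ w, a < c) (hw : RGWord c w d) :
    d = c := by
  induction w with
  | nil => exact hw.symm
  | cons b w ih =>
    rcases hw with ⟨_, hw⟩ | ⟨hb, _⟩
    · exact ih (fun a ha => h a (by simp [ha])) hw
    · have := h b (by simp); omega

/-- A word that learns a new letter splits at the first such place. -/
theorem exists_split {w : List ℕ} {c d : ℕ} (h : RGWord c w d) (hcd : c < d) :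
    ∃ u v, w = u ++ c :: v ∧ (∀ a ∈ u, a < c) ∧ RGWord (c + 1) v d := by
  induction w with
  | nil => exact absurd h hcd.ne
  | cons b w ih =>
    rcases h with ⟨hb, h⟩ | ⟨rfl, h⟩
    · obtain ⟨u, v, rfl, hu, hv⟩ := ih h
      exact ⟨b :: u, v, rfl, by simpa using ⟨hb, hu⟩, hv⟩
    · exact ⟨[], w, rfl, by simp, h⟩

/-- Closure of restricted growth words under substitution. -/
theorem map_plug {t e e' d' : ℕ} {q g : List ℕ} (hq : RGWord e q (t + g.length))
    (hte : t ≤ e) (hte' : t ≤ e') (hlt : ∀ j < e - t, g.getD j 0 < e')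
    (hg : RGWord e' (g.drop (e - t)) d') : RGWord e' (q.map (plug t g)) d' := by
  induction q generalizing e e' with
  | nil =>
    have : e = t + g.length := hq
    subst this
    simpa using hg
  | cons a q ih =>
    rcases hq with ⟨ha, hq⟩ | ⟨rfl, hq⟩
    · refine Or.inl ⟨?_, ih hq hte hte' hlt hg⟩
      unfold plug
      split_ifs with h
      · omega
      · exact hlt _ (by omega)
    · have hle := hq.le
      have hlen : a - t < g.length := by omega
      have hp : plug t g a = g[a - t] := by
        unfold plug
        rw [if_neg (by omega), List.getD_eq_getElem _ _ hlen]
      rw [List.drop_eq_getElem_cons hlen] at hg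
      have hs : a + 1 - t = a - t + 1 := by omega
      rw [List.map_cons, hp]
      have key : ∀ j < a + 1 - t, j < a - t ∨ j = a - t := by intro j hj; omega
      rcases hg with ⟨h1, hg⟩ | ⟨h1, hg⟩
      · refine Or.inl ⟨h1, ih hq (by omega) hte' ?_ (hs ▸ hg)⟩
        intro j hj
        rcases key j hj with h | rfl
        · exact hlt j h
        · rwa [List.getD_eq_getElem _ _ hlen]
      · refine Or.inr ⟨h1, ih hq (by omega) (by omega) ?_ (hs ▸ hg)⟩
        intro j hj
        rcases key j hj with h | rfl
        · exact (hlt j h).trans (by omega)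
        · rw [List.getD_eq_getElem _ _ hlen]; omega

theorem comp {t r d : ℕ} {f g : List ℕ} (hf : RGWord t f (t + r)) (hr : g.length = r)
    (hg : RGWord t g d) : RGWord t (f.map (plug t g)) d :=
  map_plug (hr ▸ hf) le_rfl le_rfl (by simp) (by simpa using hg)

end RGWord

theorem map_plug_map_plug {t : ℕ} {f h g : List ℕ} (hf : ∀ a ∈ f, a < t + h.length) :
    (f.map (plug t h)).map (plug t g) = f.map (plug t (h.map (plug t g))) := by
  rw [List.map_map]
  refine List.map_congr_left fun a ha => ?_
  have := hf a ha
  by_cases hat : a < t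
  · simp [plug, hat]
  · have hl : a - t < h.length := by omega
    simp only [Function.comp]
    rw [show plug t h a = h[a - t] by simp [plug, hat, hl],
      show plug t (h.map (plug t g)) a = plug t g h[a - t] by
        rw [plug, if_neg hat, List.getD_eq_getElem _ _ (by simpa using hl), List.getElem_map]]

theorem plug_eq_self {t a : ℕ} {g : List ℕ} (h : a < t) : plug t g a = a := if_pos h

theorem map_plug_eq_self {t : ℕ} {u g : List ℕ} (h : ∀ a ∈ u, a < t) : u.map (plug t g) = u := by
  conv_rhs => rw [← List.map_id u]
  exact List.map_congr_left fun a ha => plug_eq_self (h a ha)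

theorem plug_cons_self (t : ℕ) (v : List ℕ) : plug t (t :: v) = plug (t + 1) v := by
  funext a
  unfold plug
  rcases lt_trichotomy a t with h | rfl | h
  · rw [if_pos h, if_pos (by omega)]
  · simp
  · rw [if_neg (by omega), if_neg (by omega), show a - t = (a - (t + 1)) + 1 by omega]
    simp

/-- Every entry of a substituted word of length `D` over `t` letters is one of the letters. -/
theorem plug_lt {t D a : ℕ} {u : List ℕ} (ha : a < t + D) (hu : ∀ a ∈ u, a < t)
    (hD : u.length = D) : plug t u a < t := by
  unfold plug
  split_ifs with h
  · exact h
  · rw [List.getD_eq_getElem _ _ (by omega)]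
    exact hu _ (List.getElem_mem _)

/-- The block of letters coded by a coordinate of a combinatorial line over `Fin D → Fin t`. -/
def lineBlock (t D : ℕ) : Option (Fin D → Fin t) → List ℕ
  | none => List.ofFn fun d : Fin D => t + (d : ℕ)
  | some x => List.ofFn fun d => (x d : ℕ)

theorem lineBlock_lt {t D : ℕ} (o : Option (Fin D → Fin t)) : ∀ a ∈ lineBlock t D o, a < t + D := by
  intro a ha
  cases o with
  | none =>
    obtain ⟨d, rfl⟩ := (List.mem_ofFn' _ _).1 ha
    simp
  | some x =>
    obtain ⟨d, rfl⟩ := (List.mem_ofFn' _ _).1 ha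
    have := (x d).2
    show (x d : ℕ) < _
    omega

theorem rgWord_ofFn (t D : ℕ) : RGWord t (List.ofFn fun d : Fin D => t + (d : ℕ)) (t + D) := by
  induction D generalizing t with
  | zero => simp [RGWord]
  | succ D ih =>
    rw [List.ofFn_succ]
    refine Or.inr ⟨by simp, ?_⟩
    have := ih (t + 1)
    rw [show t + 1 + D = t + (D + 1) by omega] at this
    convert this using 2
    funext d
    simp
    omega

theorem rgWord_flatMap_lineBlock {ι : Type*} {t D : ℕ} (o : ι → Option (Fin D → Fin t))
    (L : List ι) (h : ∃ i ∈ L, o i = none) :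
    RGWord t (L.flatMap fun i => lineBlock t D (o i)) (t + D) := by
  induction L with
  | nil => simp at h
  | cons i L ih =>
    rw [List.flatMap_cons, RGWord.append_iff]
    cases hi : o i with
    | none =>
      refine ⟨t + D, rgWord_ofFn t D, RGWord.of_forall_lt fun a ha => ?_⟩
      obtain ⟨j, -, hj⟩ := List.mem_flatMap.1 ha
      exact lineBlock_lt _ a hj
    | some x =>
      refine ⟨t, RGWord.of_forall_lt fun a ha => ?_, ih ?_⟩
      · obtain ⟨d, rfl⟩ := (List.mem_ofFn' _ _).1 ha
        exact (x d).2
      · obtain ⟨j, hj, hjn⟩ := h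
        rcases List.mem_cons.1 hj with rfl | hj
        · simp [hi] at hjn
        · exact ⟨j, hj, hjn⟩

/-- The multidimensional Hales–Jewett theorem in terms of restricted growth words. -/
theorem hales_jewett_rgWord (t D : ℕ) (κ : Type) [Finite κ] :
    ∃ N, ∀ χ : List ℕ → κ, ∃ f : List ℕ, f.length = N ∧ RGWord t f (t + D) ∧
      ∃ i, ∀ u : List ℕ, u.length = D → (∀ a ∈ u, a < t) → χ (f.map (plug t u)) = i := by
  obtain ⟨ι, _, h⟩ := Combinatorics.Line.exists_mono_in_high_dimension (Fin D → Fin t) κ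
  refine ⟨Fintype.card ι * D, fun χ => ?_⟩
  obtain ⟨l, i, hl⟩ := h fun x =>
    χ ((Finset.univ : Finset ι).toList.flatMap fun j => lineBlock t D (some (x j)))
  refine ⟨(Finset.univ : Finset ι).toList.flatMap fun j => lineBlock t D (l.idxFun j), ?_,
    rgWord_flatMap_lineBlock _ _ ?_, i, fun u hu hut => ?_⟩
  · rw [List.length_flatMap]
    have : (fun j => (lineBlock t D (l.idxFun j)).length) = fun _ => D := by
      funext j
      cases l.idxFun j <;> simp [lineBlock]
    simp [this]
  · obtain ⟨j, hj⟩ := l.proper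
    exact ⟨j, by simp, hj⟩
  · rw [← hl fun d => ⟨u[d], hut _ (List.getElem_mem _)⟩, List.map_flatMap]
    congr 2
    funext j
    rw [Combinatorics.Line.coe_apply]
    generalize l.idxFun j = o
    cases o with
    | none =>
      simp only [lineBlock, List.map_ofFn, Option.getD_none]
      congr 1
      funext d
      simp [plug, hu]
    | some x =>
      exact map_plug_eq_self fun a ha => by
        obtain ⟨d, rfl⟩ := (List.mem_ofFn' _ _).1 ha
        exact (x d).2

/-- Shift of the parameters by one, fixing the letters below `t`. -/
def shiftParam (t a : ℕ) : ℕ := if a < t then a else a + 1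

theorem RGWord.map_shiftParam {t e d : ℕ} {q : List ℕ} (h : RGWord e q d) (hte : t ≤ e) :
    RGWord (e + 1) (q.map (shiftParam t)) (d + 1) := by
  induction q generalizing e with
  | nil => exact congrArg (· + 1) h
  | cons a q ih =>
    rcases h with ⟨ha, h⟩ | ⟨rfl, h⟩
    · refine Or.inl ⟨?_, ih h hte⟩
      unfold shiftParam
      split_ifs <;> omega
    · exact Or.inr ⟨by simp [shiftParam, hte], ih h (by omega)⟩

theorem map_shiftParam_map_plug_cons (t b : ℕ) (v f : List ℕ) :
    (f.map (shiftParam t)).map (plug t (b :: v)) = f.map (plug t v) := by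
  rw [List.map_map]
  congr 1
  funext a
  by_cases h : a < t
  · simp [plug, shiftParam, h]
  · simp [plug, shiftParam, h, show ¬ a + 1 < t by omega, show a + 1 - t = a - t + 1 by omega]

/-- The colour of a word with `m + 1` parameters can be made to depend only on the part before the
first parameter. -/
theorem exists_color_initial {t m : ℕ}
    (ih : ∀ (r : ℕ) (κ : Type) [Finite κ], ∃ N, ∀ χ : List ℕ → κ, ∃ f : List ℕ,
      f.length = N ∧ RGWord (t + 1) f (t + 1 + r) ∧ ∃ i, ∀ g : List ℕ, g.length = r →
        RGWord (t + 1) g (t + 1 + m) → χ (f.map (plug (t + 1) g)) = i) (R : ℕ) :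
    ∀ (κ : Type) [Finite κ], ∃ N, ∀ χ : List ℕ → κ, ∃ f : List ℕ, f.length = N ∧
      RGWord t f (t + R) ∧ ∃ c : List ℕ → κ, ∀ u v : List ℕ, (∀ a ∈ u, a < t) →
        RGWord (t + 1) v (t + 1 + m) → u.length + 1 + v.length = R →
          χ (f.map (plug t (u ++ t :: v))) = c u := by
  induction R with
  | zero =>
    intro κ _
    exact ⟨0, fun χ => ⟨[], rfl, rfl, fun _ => χ [], fun u v _ _ h => by omega⟩⟩
  | succ R ihR =>
    intro κ _
    obtain ⟨r, hr⟩ := ihR (Fin t → κ)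
    obtain ⟨N, hN⟩ := ih r κ
    refine ⟨N + 1, fun χ => ?_⟩
    obtain ⟨f, hfN, hf, i, hi⟩ := hN fun w => χ (t :: w)
    obtain ⟨f', hf'r, hf', c, hc⟩ :=
      hr fun w a => χ ((t :: f).map (plug t ((a : ℕ) :: w)))
    have hf1 : RGWord t (t :: f) (t + (r + 1)) :=
      Or.inr ⟨rfl, by rwa [show t + (r + 1) = t + 1 + r by omega]⟩
    have hf2 : RGWord t (t :: f'.map (shiftParam t)) (t + (R + 1)) :=
      Or.inr ⟨rfl, hf'.map_shiftParam le_rfl⟩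
    have hlen : (t :: f'.map (shiftParam t)).length = r + 1 := by simp [hf'r]
    refine ⟨(t :: f).map (plug t (t :: f'.map (shiftParam t))), by simp [hfN],
      hf1.comp hlen hf2,
      fun u => match u with
        | [] => i
        | a :: u => if h : a < t then c u ⟨a, h⟩ else i, fun u v hu hv huv => ?_⟩
    rw [map_plug_map_plug fun a ha => by rw [hlen]; exact hf1.lt_of_mem a ha]
    cases u with
    | nil =>
      simp only [List.nil_append, List.length_nil] at huv ⊢
      have hvR : v.length = R := by omega
      have h1 : (t :: f'.map (shiftParam t)).map (plug t (t :: v)) = t :: f'.map (plug t v) := by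
        rw [List.map_cons, map_shiftParam_map_plug_cons]
        simp [plug]
      have hf'v : RGWord (t + 1) (f'.map (plug t v)) (t + 1 + m) :=
        RGWord.map_plug (hvR.symm ▸ hf') le_rfl (by omega) (by simp) (by simpa using hv)
      rw [h1, List.map_cons, plug_cons_self,
        show plug (t + 1) (f'.map (plug t v)) t = t by simp [plug]]
      exact hi _ (by simp [hf'r]) hf'v
    | cons a u =>
      have ha : a < t := hu a (by simp)
      simp only [ha, dif_pos]
      rw [← hc u v (fun b hb => hu b (by simp [hb])) hv (by simp at huv; omega)]
      rw [List.cons_append, List.map_cons (f := plug t (a :: _)), map_shiftParam_map_plug_cons,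
        show plug t (a :: (u ++ t :: v)) t = a by simp [plug]]

/-- `MonoPrefix c i t f r`: the word `f` has `r` parameters, and the prefixes of `f` before the
first occurrences of its parameters receive colour `i` under all substitutions of letters. -/
inductive MonoPrefix {κ : Type} (c : List ℕ → κ) (i : κ) (t : ℕ) : List ℕ → ℕ → Prop
  | nil : MonoPrefix c i t [] 0
  | letter {f : List ℕ} {r a : ℕ} : MonoPrefix c i t f r → a < t + r →
      MonoPrefix c i t (f ++ [a]) r
  | param {f : List ℕ} {r : ℕ} : MonoPrefix c i t f r →
      (∀ u : List ℕ, u.length = r → (∀ a ∈ u, a < t) → c (f.map (plug t u)) = i) →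
      MonoPrefix c i t (f ++ [t + r]) (r + 1)

namespace MonoPrefix

variable {κ : Type} {c : List ℕ → κ} {i : κ} {t : ℕ}

theorem rgWord {f : List ℕ} {r : ℕ} (h : MonoPrefix c i t f r) : RGWord t f (t + r) := by
  induction h with
  | nil => rfl
  | letter _ ha ih => exact RGWord.append_iff.2 ⟨_, ih, Or.inl ⟨ha, rfl⟩⟩
  | param _ _ ih => exact RGWord.append_iff.2 ⟨_, ih, Or.inr ⟨rfl, rfl⟩⟩

theorem append {f : List ℕ} {r : ℕ} (h : MonoPrefix c i t f r) (q : List ℕ)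
    (hq : ∀ a ∈ q, a < t + r) : MonoPrefix c i t (f ++ q) r := by
  induction q generalizing f with
  | nil => simpa using h
  | cons a q ih =>
    have := ih (h.letter (hq a (by simp))) fun b hb => hq b (by simp [hb])
    simpa using this

theorem exists_split {f : List ℕ} {r : ℕ} (h : MonoPrefix c i t f r) {s : ℕ} (hs : s < r) :
    ∃ p q, f = p ++ (t + s) :: q ∧ RGWord t p (t + s) ∧
      ∀ u : List ℕ, u.length = s → (∀ a ∈ u, a < t) → c (p.map (plug t u)) = i := by
  induction h with
  | nil => omega
  | letter _ _ ih =>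
    obtain ⟨p, q, hf, h⟩ := ih hs
    exact ⟨p, q ++ [_], by rw [hf]; simp; rfl, h⟩
  | @param f r hf hc ih =>
    rcases (Nat.lt_succ_iff.1 hs).lt_or_eq with h | rfl
    · obtain ⟨p, q, hf, h⟩ := ih h
      exact ⟨p, q ++ [_], by rw [hf]; simp; rfl, h⟩
    · exact ⟨f, [], rfl, hf.rgWord, hc⟩

end MonoPrefix

/-- The part of the word `f` before the first occurrence of `a`. -/
def before (f : List ℕ) (a : ℕ) : List ℕ := f.takeWhile (· ≠ a)

theorem before_eq_self {f : List ℕ} {a : ℕ} (h : ∀ b ∈ f, b < a) : before f a = f :=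
  List.takeWhile_eq_self_iff.2 fun b hb => by simpa using (h b hb).ne

theorem before_append_cons {u v : List ℕ} {a : ℕ} (h : ∀ b ∈ u, b < a) :
    before (u ++ a :: v) a = u := by
  rw [before, List.takeWhile_append_of_pos fun b hb => by simpa using (h b hb).ne]
  simp

theorem RGWord.exists_split_of_le {w : List ℕ} {c d s : ℕ} (h : RGWord c w d) (hcs : c ≤ s)
    (hsd : s < d) : ∃ u v, w = u ++ s :: v ∧ (∀ a ∈ u, a < s) ∧ RGWord (s + 1) v d := by
  induction s, hcs using Nat.le_induction with
  | base => exact h.exists_split hsd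
  | succ s hs ih =>
    obtain ⟨u, v, rfl, hu, hv⟩ := ih (by omega)
    obtain ⟨u', v', rfl, hu', hv'⟩ := hv.exists_split hsd
    refine ⟨u ++ s :: u', v', by simp, fun a ha => ?_, hv'⟩
    simp only [List.mem_append, List.mem_cons] at ha
    rcases ha with h | rfl | h
    · have := hu a h
      omega
    · omega
    · exact hu' a h

theorem before_lt {t D s : ℕ} {f : List ℕ} (hf : RGWord t f (t + D)) (hs : s ≤ D) :
    ∀ a ∈ before f (t + s), a < t + s := by
  rcases hs.lt_or_eq with h | rfl
  · obtain ⟨u, v, rfl, hu, -⟩ := hf.exists_split_of_le (s := t + s) (by omega) (by omega)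
    rwa [before_append_cons hu]
  · rw [before_eq_self hf.lt_of_mem]
    exact hf.lt_of_mem

theorem before_succ {t D s : ℕ} {f : List ℕ} (hf : RGWord t f (t + D)) (hs : s < D) :
    ∃ q, before f (t + (s + 1)) = before f (t + s) ++ (t + s) :: q ∧ ∀ a ∈ q, a < t + (s + 1) := by
  have hlt := before_lt hf (Nat.succ_le_of_lt hs)
  suffices ∃ q, before f (t + (s + 1)) = before f (t + s) ++ (t + s) :: q by
    obtain ⟨q, hq⟩ := this
    refine ⟨q, hq, fun a ha => hlt a ?_⟩
    rw [Nat.succ_eq_add_one, hq]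
    simp [ha]
  obtain ⟨u, v, rfl, hu, hv⟩ := hf.exists_split_of_le (s := t + s) (by omega) (by omega)
  refine ⟨before v (t + (s + 1)), ?_⟩
  rw [before_append_cons hu, before, List.takeWhile_append_of_pos, List.takeWhile_cons_of_pos,
    before]
  · simp
  · intro a ha
    have := hu a ha
    simp
    omega

theorem plug_append {t a : ℕ} {g : List ℕ} (h : List ℕ) (ha : a < t + g.length) :
    plug t (g ++ h) a = plug t g a := by
  unfold plug
  split_ifs
  · rfl
  · rw [List.getD_append _ _ _ _ (by omega)]

/-- Transport of `MonoPrefix` along substitution. -/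
theorem MonoPrefix.comp {κ : Type} {c : List ℕ → κ} {i : κ} {t D : ℕ} {f : List ℕ}
    (hf : RGWord t f (t + D)) {g : List ℕ} {r : ℕ}
    (hg : MonoPrefix (fun u => c ((before f (t + u.length)).map (plug t u))) i t g r)
    (hgD : g.length ≤ D) :
    MonoPrefix c i t ((before f (t + g.length)).map (plug t g)) r := by
  have step : ∀ (g : List ℕ) (a r : ℕ), g.length < D → (∀ b ∈ g, b < t + r) → a < t + r →
      ∃ q, (before f (t + (g ++ [a]).length)).map (plug t (g ++ [a])) =
        (before f (t + g.length)).map (plug t g) ++ [a] ++ q ∧ ∀ b ∈ q, b < t + r := by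
    intro g a r hg hgr ha
    obtain ⟨q, hq, hqlt⟩ := before_succ hf hg
    refine ⟨q.map (plug t (g ++ [a])), ?_, fun b hb => ?_⟩
    · rw [List.length_append, List.length_singleton, hq, List.map_append, List.map_cons,
        show plug t (g ++ [a]) (t + g.length) = a by simp [plug],
        List.map_congr_left fun b hb => plug_append [a] (before_lt hf hg.le b hb)]
      simp
    · obtain ⟨b, hbq, rfl⟩ := List.mem_map.1 hb
      have := hqlt b hbq
      unfold plug
      split_ifs
      · omega
      · rw [List.getD_eq_getElem _ _ (by simp; omega)]
        have hmem := List.getElem_mem (l := g ++ [a]) (n := b - t) (by simp; omega)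
        rcases List.mem_append.1 hmem with h | h
        · exact hgr _ h
        · rw [List.mem_singleton.1 h]
          exact ha
  induction hg with
  | nil =>
    have h : ∀ a ∈ before f (t + 0), a < t := before_lt hf (Nat.zero_le D)
    rw [List.length_nil, map_plug_eq_self h]
    exact MonoPrefix.nil.append _ h
  | @letter g r a hg ha ih =>
    simp only [List.length_append, List.length_singleton] at hgD
    obtain ⟨q, hq, hqlt⟩ := step g a r hgD hg.rgWord.lt_of_mem ha
    rw [hq]
    exact ((ih (by omega)).letter ha).append q hqlt
  | @param g r hg hc ih =>
    simp only [List.length_append, List.length_singleton] at hgD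
    obtain ⟨q, hq, hqlt⟩ := step g (t + r) (r + 1) hgD
      (fun b hb => (hg.rgWord.lt_of_mem b hb).trans (by omega)) (by omega)
    rw [hq]
    refine ((ih (by omega)).param fun u hu hut => ?_).append q hqlt
    rw [map_plug_map_plug (before_lt hf (by omega))]
    simpa using hc u hu hut

/-- Iterating the Hales–Jewett theorem makes the colours of prefixes constant. -/
theorem exists_monoPrefix {t : ℕ} (ht : 0 < t) (κ : Type) [Fintype κ] (n : ℕ) :
    ∀ ρ : κ → ℕ, ∑ i, ρ i = n → ∃ R, ∀ N, R ≤ N → ∀ c : List ℕ → κ,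
      ∃ i f, f.length = N ∧ MonoPrefix c i t f (ρ i) := by
  induction n with
  | zero =>
    intro ρ hρ
    refine ⟨0, fun N _ c => ⟨c [], List.replicate N 0, by simp, ?_⟩⟩
    have : ρ (c []) = 0 := by simpa using (Finset.sum_eq_zero_iff.1 hρ) (c [])
    rw [this]
    simpa using MonoPrefix.nil.append (List.replicate N 0)
      (fun a ha => by rw [List.eq_of_mem_replicate ha]; omega)
  | succ n ih =>
    intro ρ hρ
    by_cases h0 : ∃ i, ρ i = 0
    · obtain ⟨i, hi⟩ := h0
      refine ⟨0, fun N _ c => ⟨i, List.replicate N 0, by simp, ?_⟩⟩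
      rw [hi]
      simpa using MonoPrefix.nil.append (List.replicate N 0)
        (fun a ha => by rw [List.eq_of_mem_replicate ha]; omega)
    · push Not at h0
      have hex : ∀ i, ∃ R, ∀ N, R ≤ N → ∀ c : List ℕ → κ,
          ∃ j f, f.length = N ∧ MonoPrefix c j t f (Function.update ρ i (ρ i - 1) j) := by
        intro i
        refine ih _ ?_
        rw [Finset.sum_update_of_mem (Finset.mem_univ i)]
        rw [← Finset.add_sum_erase _ _ (Finset.mem_univ i)] at hρ
        have := h0 i
        rw [Finset.sdiff_singleton_eq_erase]
        omega
      choose R hR using hex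
      obtain ⟨N, hN⟩ := hales_jewett_rgWord t (∑ i, R i) κ
      refine ⟨N + 1, fun M hM c => ?_⟩
      obtain ⟨f, hfN, hf, i, hi⟩ := hN c
      obtain ⟨j, g, hg, hmono⟩ := hR i (∑ i, R i)
        (Finset.single_le_sum (f := R) (fun _ _ => Nat.zero_le _) (Finset.mem_univ i))
        fun u => c ((before f (t + u.length)).map (plug t u))
      have hcomp := hmono.comp hf hg.le
      rw [hg, before_eq_self hf.lt_of_mem] at hcomp
      have hpad : ∀ {f : List ℕ} {j : κ}, f.length ≤ M → MonoPrefix c j t f (ρ j) →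
          ∃ i f, f.length = M ∧ MonoPrefix c i t f (ρ i) := by
        intro f j hf h
        refine ⟨j, f ++ List.replicate (M - f.length) 0, by simp; omega, h.append _ ?_⟩
        intro a ha
        rw [List.eq_of_mem_replicate ha]
        omega
      by_cases hij : j = i
      · subst hij
        rw [Function.update_self] at hcomp hmono
        refine hpad (f := f.map (plug t g) ++ [t + (ρ j - 1)]) (j := j) (by simp; omega) ?_
        have := h0 j
        rw [show ρ j = ρ j - 1 + 1 by omega]
        refine hcomp.param fun u hu hut => ?_
        rw [map_plug_map_plug fun a ha => by rw [hg]; exact hf.lt_of_mem a ha]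
        refine hi _ (by simpa using hg) fun a ha => ?_
        obtain ⟨b, hb, rfl⟩ := List.mem_map.1 ha
        exact plug_lt (hmono.rgWord.lt_of_mem b hb) hut hu
      · rw [Function.update_of_ne hij] at hcomp
        exact hpad (by simp; omega) hcomp

/-- The Graham–Rothschild theorem for restricted growth words over a nonempty alphabet. -/
theorem graham_rothschild (m : ℕ) : ∀ t, 0 < t → ∀ (r : ℕ) (κ : Type) [Finite κ],
    ∃ N, ∀ χ : List ℕ → κ, ∃ f : List ℕ, f.length = N ∧ RGWord t f (t + r) ∧
      ∃ i, ∀ g : List ℕ, g.length = r → RGWord t g (t + m) → χ (f.map (plug t g)) = i := by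
  induction m with
  | zero =>
    intro t _ r κ _
    obtain ⟨N, hN⟩ := hales_jewett_rgWord t r κ
    refine ⟨N, fun χ => ?_⟩
    obtain ⟨f, hfN, hf, i, hi⟩ := hN χ
    exact ⟨f, hfN, hf, i, fun g hg hgt => hi g hg hgt.lt_of_mem⟩
  | succ m ih =>
    intro t ht r κ _
    have := Fintype.ofFinite κ
    obtain ⟨R, hR⟩ := exists_monoPrefix ht κ _ (fun _ => r) rfl
    obtain ⟨N, hN⟩ := exists_color_initial (t := t) (m := m) (ih (t + 1) (by omega)) R κ
    refine ⟨N, fun χ => ?_⟩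
    obtain ⟨f, hfN, hf, c, hc⟩ := hN χ
    obtain ⟨i, h, hhR, hmono⟩ := hR R le_rfl c
    refine ⟨f.map (plug t h), by simpa using hfN, hf.comp hhR hmono.rgWord, i,
      fun g hgr hg => ?_⟩
    rw [map_plug_map_plug fun a ha => by rw [hhR]; exact hf.lt_of_mem a ha]
    obtain ⟨u, v, rfl, hu, hv⟩ := hg.exists_split (by omega)
    simp only [List.length_append, List.length_cons] at hgr
    obtain ⟨p, q, hpq, hp, hpc⟩ := hmono.exists_split (s := u.length) (by omega)
    have hcomp := hmono.rgWord.comp (g := u ++ t :: v) (by simpa using hgr) hg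
    have hpu : p.map (plug t (u ++ t :: v)) = p.map (plug t u) :=
      List.map_congr_left fun b hb => plug_append _ (hp.lt_of_mem b hb)
    have hput : ∀ a ∈ p.map (plug t u), a < t := by
      intro a ha
      obtain ⟨b, hb, rfl⟩ := List.mem_map.1 ha
      exact plug_lt (hp.lt_of_mem b hb) hu rfl
    have hmap : h.map (plug t (u ++ t :: v)) =
        p.map (plug t u) ++ t :: q.map (plug t (u ++ t :: v)) := by
      rw [hpq, List.map_append, List.map_cons, hpu]
      simp [plug]
    rw [hmap] at hcomp ⊢
    rw [← hpc u rfl hu]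
    refine hc _ _ hput ?_ ?_
    · obtain ⟨e, he, hq⟩ := RGWord.append_iff.1 hcomp
      obtain rfl := RGWord.eq_of_forall_lt hput he
      rcases hq with ⟨h, -⟩ | ⟨-, hq⟩
      · omega
      · rwa [show e + 1 + m = e + (m + 1) by omega]
    · have := congrArg List.length hpq
      simp only [List.length_append, List.length_cons] at this
      simp only [List.length_map]
      omega

/-- The finite dual Ramsey theorem for restricted growth words. -/
theorem dual_ramsey_rgWord (m r : ℕ) (κ : Type) [Finite κ] :
    ∃ N, ∀ χ : List ℕ → κ, ∃ f : List ℕ, f.length = N ∧ RGWord 0 f r ∧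
      ∃ i, ∀ g : List ℕ, g.length = r → RGWord 0 g m → χ (f.map (plug 0 g)) = i := by
  cases r with
  | zero =>
    refine ⟨0, fun χ => ⟨[], rfl, rfl, χ [], fun g _ _ => rfl⟩⟩
  | succ r =>
    obtain ⟨N, hN⟩ := graham_rothschild (m - 1) 1 one_pos r κ
    refine ⟨N + 1, fun χ => ?_⟩
    obtain ⟨f, hfN, hf, i, hi⟩ := hN fun w => χ (0 :: w)
    refine ⟨0 :: f, by simp [hfN], Or.inr ⟨rfl, by rwa [add_comm 1 r] at hf⟩, i,
      fun g hgr hg => ?_⟩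
    cases g with
    | nil => simp at hgr
    | cons a g =>
      rcases hg with ⟨h, -⟩ | ⟨rfl, hg⟩
      · omega
      · rw [List.map_cons, plug_cons_self, show plug (0 + 1) g 0 = 0 by simp [plug]]
        refine hi g (by simpa using hgr) ?_
        have := hg.le
        rwa [show 1 + (m - 1) = m by omega]

theorem tpRel_loop {A : Type*} [LinearOrder A] (x : A) :
    tpRel [x, x] = fun i j => i < 2 ∧ j < 2 := by
  funext i j
  refine propext ⟨fun ⟨hi, hj, _⟩ => ⟨hi, hj⟩, fun ⟨hi, hj⟩ => ⟨hi, hj, ?_⟩⟩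
  interval_cases i <;> interval_cases j <;> simp

theorem tpRel_edge {A : Type*} [LinearOrder A] {x y : A} (h : x < y) :
    tpRel [x, y] = fun i j => i < 2 ∧ j < 2 ∧ i ≤ j := by
  funext i j
  refine propext ⟨fun ⟨hi, hj, hij⟩ => ⟨hi, hj, ?_⟩, fun ⟨hi, hj, hij⟩ => ⟨hi, hj, ?_⟩⟩
  · simp only [List.length_cons, List.length_nil] at hi hj
    interval_cases i <;> interval_cases j <;> simp_all [h.not_ge]
  · interval_cases i <;> interval_cases j <;> simp_all [h.le]

theorem card_classesOf_loop : (classesOf (fun i j => i < 2 ∧ j < 2) 2).card = 1 := by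
  have h0 : classOf (fun i j => i < 2 ∧ j < 2) 2 0 = {0, 1} := by
    ext a; simp [classOf]; omega
  have h1 : classOf (fun i j => i < 2 ∧ j < 2) 2 1 = {0, 1} := by
    ext a; simp [classOf]; omega
  rw [classesOf, show Finset.range 2 = {0, 1} from rfl, Finset.image_insert,
    Finset.image_singleton, h0, h1]
  rfl

theorem card_classesOf_edge : (classesOf (fun i j => i < 2 ∧ j < 2 ∧ i ≤ j) 2).card = 2 := by
  have : classesOf (fun i j => i < 2 ∧ j < 2 ∧ i ≤ j) 2 = {{0}, {1}} := by
    have h0 : classOf (fun i j => i < 2 ∧ j < 2 ∧ i ≤ j) 2 0 = {0} := by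
      ext a; simp [classOf]; omega
    have h1 : classOf (fun i j => i < 2 ∧ j < 2 ∧ i ≤ j) 2 1 = {1} := by
      ext a; simp [classOf]; omega
    rw [classesOf, show Finset.range 2 = {0, 1} from rfl, Finset.image_insert,
      Finset.image_singleton, h0, h1]
  rw [this]
  rfl

theorem quasiLT_irrefl (n : ℕ) (σ : ℕ → ℕ → Prop) : ¬ quasiLT n σ σ := by
  rintro (h | ⟨-, M, h1, h2, -⟩)
  · exact lt_irrefl _ h
  · exact h2 h1

theorem altLex_pair {A : Type*} [LinearOrder A] {x y x' y' : A} (h : x ≤ y) (h' : x' ≤ y')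
    (hxy : x = y ↔ x' = y') :
    altLex [x, y].toFinset [x', y'].toFinset ↔ y < y' ∨ (y = y' ∧ x < x') := by
  simp only [altLex, List.mem_toFinset, List.mem_cons, List.not_mem_nil, or_false]
  constructor
  · rintro ⟨m, hm, hm', hz⟩
    rcases lt_trichotomy y y' with hy | rfl | hy
    · exact Or.inl hy
    · push Not at hm'
      obtain rfl : m = x' := hm.resolve_right hm'.2
      refine Or.inr ⟨rfl, not_le.1 fun hlt => ?_⟩
      have h1 := (hz x (lt_of_le_of_ne hlt hm'.1)).1 (Or.inl rfl)
      rcases h1 with h1 | h1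
      · exact hm'.1 h1.symm
      · exact hm'.2 (hxy.1 h1)
    · have hmy : m ≤ y' := by rcases hm with rfl | rfl <;> simp [*]
      have h1 := (hz y (hmy.trans_lt hy)).1 (Or.inr rfl)
      rcases h1 with h1 | h1
      · exact absurd (h1 ▸ hy) (not_lt.2 h')
      · exact absurd h1 hy.ne'
  · rintro (hy | ⟨rfl, hx⟩)
    · refine ⟨y', Or.inr rfl, ?_, fun z hz => ?_⟩
      · rintro (rfl | rfl)
        · exact absurd hy (not_lt.2 h)
        · exact lt_irrefl _ hy
      · constructor
        · rintro (rfl | rfl)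
          · exact absurd (hy.trans hz) (not_lt.2 h)
          · exact absurd hz hy.not_gt
        · rintro (rfl | rfl)
          · exact absurd hz (not_lt.2 h')
          · exact absurd hz (lt_irrefl _)
    · refine ⟨x', Or.inl rfl, ?_, fun z hz => ?_⟩
      · rintro (rfl | hxy')
        · exact lt_irrefl _ hx
        · exact hx.ne ((hxy.2 hxy').trans hxy'.symm)
      · constructor
        · rintro (rfl | rfl)
          · exact absurd hz hx.not_gt
          · exact Or.inr rfl
        · rintro (rfl | rfl)
          · exact absurd hz (lt_irrefl _)
          · exact Or.inr rfl

/-- A key whose order on pairs `(x, y)` with `x ≤ y` is the special anti-lexicographic order. -/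
def pairKey {A : Type*} [LinearOrder A] (p : A × A) : Bool ×ₗ (A ×ₗ A) :=
  toLex (decide (p.1 ≠ p.2), toLex (p.2, p.1))

theorem pairKey_injective {A : Type*} [LinearOrder A] :
    Function.Injective (pairKey : A × A → Bool ×ₗ (A ×ₗ A)) := by
  rintro ⟨x, y⟩ ⟨x', y'⟩ h
  simp only [pairKey, EmbeddingLike.apply_eq_iff_eq, Prod.mk.injEq] at h
  simp [h.2.1, h.2.2]

theorem pairKey_lt {A : Type*} [LinearOrder A] {p q : A × A} :
    pairKey p < pairKey q ↔ (p.1 = p.2 ∧ q.1 ≠ q.2) ∨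
      ((p.1 = p.2 ↔ q.1 = q.2) ∧ (p.2 < q.2 ∨ (p.2 = q.2 ∧ p.1 < q.1))) := by
  simp only [pairKey, Prod.Lex.toLex_lt_toLex]
  by_cases h : p.1 = p.2 <;> by_cases h' : q.1 = q.2 <;> simp [h, h']

theorem salLT_pair {A : Type*} [LinearOrder A] {x y x' y' : A} (h : x ≤ y) (h' : x' ≤ y') :
    salLT [x, y] [x', y'] ↔ pairKey (x, y) < pairKey (x', y') := by
  have key : (x = y ↔ x' = y') → tpRel [x, y] = tpRel [x', y'] →
      (salLT [x, y] [x', y'] ↔ pairKey (x, y) < pairKey (x', y')) := by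
    intro hiff ht
    have hne : altLex [x, y].toFinset [x', y'].toFinset →
        [x, y].toFinset ≠ [x', y'].toFinset := by
      rintro ⟨m, h1, h2, -⟩ he
      exact h2 (he ▸ h1)
    rw [pairKey_lt, salLT]
    simp only [ht, quasiLT_irrefl, hiff]
    rw [← altLex_pair h h' hiff]
    simp only [List.length_cons, false_or, true_and, ne_eq, and_not_self_iff]
    exact ⟨fun h => h.2, fun h => ⟨hne h, h⟩⟩
  rcases h.eq_or_lt with rfl | hlt <;> rcases h'.eq_or_lt with rfl | hlt'
  · exact key (by simp) (by rw [tpRel_loop, tpRel_loop])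
  · rw [pairKey_lt, salLT, tpRel_loop, tpRel_edge hlt']
    refine iff_of_true ⟨rfl, Or.inl (Or.inl ?_)⟩ (Or.inl ⟨rfl, hlt'.ne⟩)
    rw [show [x, x].length = 2 from rfl, card_classesOf_loop, card_classesOf_edge]
    exact one_lt_two
  · rw [pairKey_lt, salLT, tpRel_loop, tpRel_edge hlt]
    refine iff_of_false ?_ ?_
    · rintro ⟨-, (h | ⟨h, -⟩) | ⟨h, -⟩⟩
      · rw [show [x, y].length = 2 from rfl, card_classesOf_loop, card_classesOf_edge] at h
        omega
      · rw [show [x, y].length = 2 from rfl, card_classesOf_loop, card_classesOf_edge] at h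
        omega
      · have := congrFun (congrFun h 1) 0
        simp at this
    · simp [hlt.ne]
  · exact key (by simp [hlt.ne, hlt'.ne]) (by rw [tpRel_edge hlt, tpRel_edge hlt'])

theorem EDigObj.rel_le {M : EDigObj} {x y : M.carrier} (h : M.rel x y) : x ≤ y := by
  by_cases hxy : x = y
  · exact hxy.le
  · exact (M.ext x y h hxy).le

theorem MinWrt.exists_le {M N : EDigObj} {f : M.carrier → N.carrier} {p : M.carrier × M.carrier}
    (hp : M.rel p.1 p.2) :
    ∃ q : M.carrier × M.carrier, M.rel q.1 q.2 ∧ Prod.map f f q = Prod.map f f p ∧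
      pairKey q ≤ pairKey p ∧
      MinWrt salLT {u | u ∈ digPairs M ∧ u.map f = [f p.1, f p.2]} [q.1, q.2] := by
  obtain ⟨q, hq, hmin⟩ := Finset.exists_min_image
    (Finset.univ.filter fun q : M.carrier × M.carrier =>
      M.rel q.1 q.2 ∧ Prod.map f f q = Prod.map f f p) pairKey ⟨p, by simp [hp]⟩
  simp only [Finset.mem_filter, Finset.mem_univ, true_and] at hq hmin
  refine ⟨q, hq.1, hq.2, hmin p ⟨hp, rfl⟩, ⟨⟨q.1, q.2, hq.1, rfl⟩, ?_⟩, ?_⟩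
  · have := hq.2
    simp only [Prod.map, Prod.mk.injEq] at this
    simp [this]
  · rintro _ ⟨⟨x, y, hxy, rfl⟩, hf⟩
    have := hmin (x, y) ⟨hxy, by simpa [Prod.map] using hf⟩
    rw [salLT_pair (EDigObj.rel_le hq.1) (EDigObj.rel_le hxy)]
    rcases this.eq_or_lt with h | h
    · left
      rw [pairKey_injective h]
    · exact Or.inr h

/-- Strong rigid quotient maps in terms of the keys of related pairs. -/
theorem isSRQdig_iff {M N : EDigObj} {f : M.carrier → N.carrier} :
    IsSRQdig M N f ↔ (∀ x y, M.rel x y → N.rel (f x) (f y)) ∧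
      (∀ q : N.carrier × N.carrier, N.rel q.1 q.2 →
        ∃ p : M.carrier × M.carrier, M.rel p.1 p.2 ∧ Prod.map f f p = q) ∧
      ∀ (q : N.carrier × N.carrier) (p : M.carrier × M.carrier), N.rel q.1 q.2 → M.rel p.1 p.2 →
        pairKey q < pairKey (Prod.map f f p) →
          ∃ p' : M.carrier × M.carrier, M.rel p'.1 p'.2 ∧ Prod.map f f p' = q ∧
            pairKey p' < pairKey p := by
  constructor
  · rintro ⟨hom, -, hsurj, hrig⟩
    have surj : ∀ q : N.carrier × N.carrier, N.rel q.1 q.2 →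
        ∃ p : M.carrier × M.carrier, M.rel p.1 p.2 ∧ Prod.map f f p = q := by
      intro q hq
      obtain ⟨_, ⟨x, y, hxy, rfl⟩, h⟩ := hsurj [q.1, q.2] ⟨_, _, hq, rfl⟩
      refine ⟨(x, y), hxy, ?_⟩
      simp only [List.map_cons, List.map_nil, List.cons.injEq, and_true] at h
      exact Prod.ext h.1 h.2
    refine ⟨hom, surj, fun q p hq hp hlt => ?_⟩
    obtain ⟨p₁, hp₁, rfl⟩ := surj q hq
    obtain ⟨a, ha, haf, -, hamin⟩ := MinWrt.exists_le (f := f) hp₁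
    obtain ⟨b, hb, -, hbp, hbmin⟩ := MinWrt.exists_le (f := f) hp
    have h1 := hom _ _ hp₁
    have h2 := hom _ _ hp
    have := hrig _ ⟨_, _, h1, rfl⟩ _ ⟨_, _, h2, rfl⟩
      ((salLT_pair (EDigObj.rel_le h1) (EDigObj.rel_le h2)).2 hlt) _ _ hamin hbmin
    rw [salLT_pair (EDigObj.rel_le ha) (EDigObj.rel_le hb)] at this
    exact ⟨a, ha, haf, this.trans_le hbp⟩
  · rintro ⟨hom, surj, hrig⟩
    refine ⟨hom, ?_, ?_, ?_⟩
    · rintro _ ⟨x, y, h, rfl⟩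
      exact ⟨f x, f y, hom x y h, rfl⟩
    · rintro _ ⟨x, y, h, rfl⟩
      obtain ⟨p, hp, hpf⟩ := surj (x, y) h
      simp only [Prod.map, Prod.mk.injEq] at hpf
      exact ⟨[p.1, p.2], ⟨_, _, hp, rfl⟩, by simp [hpf]⟩
    · rintro _ ⟨x, y, h, rfl⟩ _ ⟨x', y', h', rfl⟩ hlt _ _ ⟨⟨⟨a, a', ha, rfl⟩, haf⟩, hamin⟩
        ⟨⟨⟨b, b', hb, rfl⟩, hbf⟩, hbmin⟩
      simp only [List.map_cons, List.map_nil, List.cons.injEq, and_true] at haf hbf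
      obtain ⟨rfl, rfl⟩ := haf
      obtain ⟨rfl, rfl⟩ := hbf
      rw [salLT_pair (EDigObj.rel_le h) (EDigObj.rel_le h')] at hlt
      obtain ⟨p, hp, hpf, hpb⟩ := hrig (f a, f a') (b, b') h hb hlt
      simp only [Prod.map, Prod.mk.injEq] at hpf
      rw [salLT_pair (EDigObj.rel_le ha) (EDigObj.rel_le hb)]
      rcases hamin [p.1, p.2] ⟨⟨_, _, hp, rfl⟩, by simp [hpf]⟩ with h | h
      · simp only [List.cons.injEq, and_true] at h
        rwa [← h.1, ← h.2]
      · rw [salLT_pair (EDigObj.rel_le ha) (EDigObj.rel_le hp)] at h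
        exact h.trans hpb

namespace RGWord

theorem exists_getD_eq {w : List ℕ} {c d b : ℕ} (h : RGWord c w d) (hcb : c ≤ b) (hbd : b < d) :
    ∃ j < w.length, w.getD j 0 = b := by
  obtain ⟨u, v, rfl, -, -⟩ := h.exists_split_of_le hcb hbd
  exact ⟨u.length, by simp, by simp⟩

theorem exists_lt_getD_eq {w : List ℕ} {c d b i : ℕ} (h : RGWord c w d) (hi : i < w.length)
    (hcb : c ≤ b) (hb : b < w.getD i 0) : ∃ j < i, w.getD j 0 = b := by
  induction w generalizing c i with
  | nil => simp at hi
  | cons a w ih =>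
    cases i with
    | zero =>
      rw [List.getD_cons_zero] at hb
      rcases h with ⟨h, -⟩ | ⟨h, -⟩ <;> omega
    | succ i =>
      have step : ∀ {e}, e ≤ b → RGWord e w d → ∃ j < i + 1, (a :: w).getD j 0 = b := by
        intro e he hw
        obtain ⟨j, hj, hjb⟩ := ih hw (by simpa using hi) he (by simpa using hb)
        exact ⟨j + 1, by omega, by simpa using hjb⟩
      rcases h with ⟨-, h⟩ | ⟨rfl, h⟩
      · exact step hcb h
      · rcases hcb.eq_or_lt with rfl | hab
        · exact ⟨0, by omega, by simp⟩
        · exact step hab h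

theorem of_exists {w : List ℕ} {c d : ℕ} (hcd : c ≤ d) (hlt : ∀ a ∈ w, a < d)
    (hmem : ∀ b, c ≤ b → b < d → b ∈ w)
    (hfirst : ∀ i < w.length, ∀ b, c ≤ b → b < w.getD i 0 → ∃ j < i, w.getD j 0 = b) :
    RGWord c w d := by
  induction w generalizing c with
  | nil =>
    by_contra hne
    have : c ≠ d := hne
    simpa using hmem c le_rfl (by omega)
  | cons a w ih =>
    have hac : a ≤ c := by
      by_contra hac
      obtain ⟨j, hj, -⟩ := hfirst 0 (by simp) c le_rfl (by simpa using hac)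
      omega
    rcases hac.lt_or_eq with hac | rfl
    · refine Or.inl ⟨hac, ih hcd (fun b hb => hlt b (by simp [hb])) (fun b hcb hbd => ?_) ?_⟩
      · exact (List.mem_cons.1 (hmem b hcb hbd)).resolve_left (by omega)
      · intro i hi b hcb hb
        obtain ⟨j, hj, hjb⟩ := hfirst (i + 1) (by simpa using hi) b hcb (by simpa using hb)
        cases j with
        | zero => simp at hjb; omega
        | succ j => exact ⟨j, by omega, by simpa using hjb⟩
    · refine Or.inr ⟨rfl, ih (hlt a (by simp)) (fun b hb => hlt b (by simp [hb]))
        (fun b hcb hbd => ?_) ?_⟩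
      · exact (List.mem_cons.1 (hmem b (by omega) hbd)).resolve_left (by omega)
      · intro i hi b hcb hb
        obtain ⟨j, hj, hjb⟩ := hfirst (i + 1) (by simpa using hi) b (by omega) (by simpa using hb)
        cases j with
        | zero => simp at hjb; omega
        | succ j => exact ⟨j, by omega, by simpa using hjb⟩

end RGWord

/-- The disjoint union of `n` arrows. -/
def arrows (n : ℕ) : EDigObj where
  carrier := Fin n ×ₗ Bool
  rel p q := p = q ∨ ((ofLex p).1 = (ofLex q).1 ∧ (ofLex p).2 = false ∧ (ofLex q).2 = true)
  refl _ := Or.inl rfl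
  ext p q h hne := by
    rcases h with h | ⟨h1, h2, h3⟩
    · exact absurd h hne
    · exact Prod.Lex.lt_iff.2 (Or.inr ⟨h1, by simp [h2, h3]⟩)

theorem arrows_isPoset (n : ℕ) :
    (∀ x y, (arrows n).rel x y → (arrows n).rel y x → x = y) ∧
      ∀ x y z, (arrows n).rel x y → (arrows n).rel y z → (arrows n).rel x z := by
  refine ⟨?_, ?_⟩
  · rintro x y (h | ⟨-, h, -⟩) (h' | ⟨-, -, h'⟩)
    · exact h
    · exact h
    · exact h'.symm
    · simp [h] at h'
  · rintro x y z (rfl | ⟨h1, h2, h3⟩) (rfl | ⟨h4, h5, h6⟩)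
    · exact Or.inl rfl
    · exact Or.inr ⟨h4, h5, h6⟩
    · exact Or.inr ⟨h1, h2, h3⟩
    · simp [h3] at h5

/-- The map on a union of arrows that sends the `i`-th arrow to the pair coded by the `i`-th
letter of a word. -/
def arrowsMap {α : Type*} (dec : ℕ → α × α) (n : ℕ) (w : List ℕ) (p : (arrows n).carrier) : α :=
  if (ofLex p).2 = true then (dec (w.getD (ofLex p).1 0)).2 else (dec (w.getD (ofLex p).1 0)).1

/-- `IsEnum M p dec`: `dec` enumerates the `p` related pairs of `M` increasingly. -/
structure IsEnum (M : EDigObj) (p : ℕ) (dec : ℕ → M.carrier × M.carrier) : Prop where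
  rel : ∀ i < p, M.rel (dec i).1 (dec i).2
  lt_iff : ∀ i < p, ∀ j < p, (pairKey (dec i) < pairKey (dec j) ↔ i < j)
  exists_eq : ∀ q : M.carrier × M.carrier, M.rel q.1 q.2 → ∃ i < p, dec i = q

theorem exists_isEnum (M : EDigObj) [Nonempty M.carrier] : ∃ p dec, IsEnum M p dec := by
  let S := (Finset.univ.filter fun q : M.carrier × M.carrier => M.rel q.1 q.2).image pairKey
  let e := S.orderIsoOfFin rfl
  have hex : ∀ i : Fin S.card, ∃ q : M.carrier × M.carrier, M.rel q.1 q.2 ∧ pairKey q = e i := by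
    intro i
    obtain ⟨q, hq, h⟩ := Finset.mem_image.1 (e i).2
    exact ⟨q, by simpa using hq, h⟩
  choose q hq hqe using hex
  refine ⟨S.card, fun i => if h : i < S.card then q ⟨i, h⟩ else Classical.arbitrary _, ?_, ?_, ?_⟩
  · intro i hi
    simpa [hi] using hq ⟨i, hi⟩
  · intro i hi j hj
    simp only [hi, hj, dif_pos, hqe]
    rw [Subtype.coe_lt_coe, OrderIso.lt_iff_lt, Fin.mk_lt_mk]
  · intro r hr
    have hmem : pairKey r ∈ S := Finset.mem_image_of_mem _ (by simpa using hr)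
    refine ⟨e.symm ⟨_, hmem⟩, Fin.is_lt _, ?_⟩
    simp only [Fin.is_lt, dif_pos]
    apply pairKey_injective
    rw [hqe]
    simp

theorem isSRQdig_arrowsMap {M : EDigObj} {p : ℕ} {dec : ℕ → M.carrier × M.carrier}
    (hdec : IsEnum M p dec) {w : List ℕ} (hw : RGWord 0 w p) :
    IsSRQdig (arrows w.length) M (arrowsMap dec w.length w) := by
  have hget : ∀ i < w.length, w.getD i 0 < p := by
    intro i hi
    rw [List.getD_eq_getElem _ _ hi]
    exact hw.lt_of_mem _ (List.getElem_mem _)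
  have hrel : ∀ i : Fin w.length, M.rel (dec (w.getD i 0)).1 (dec (w.getD i 0)).2 :=
    fun i => hdec.rel _ (hget i i.2)
  let arrow (i : Fin w.length) : (arrows w.length).carrier × (arrows w.length).carrier :=
    (toLex (i, false), toLex (i, true))
  have harrow : ∀ i, (arrows w.length).rel (arrow i).1 (arrow i).2 :=
    fun i => Or.inr ⟨rfl, rfl, rfl⟩
  have hne : ∀ i, (arrow i).1 ≠ (arrow i).2 := fun i h =>
    Bool.false_ne_true (congrArg (fun z : Fin w.length ×ₗ Bool => (ofLex z).2) h)
  have hmap : ∀ i, Prod.map (arrowsMap dec w.length w) (arrowsMap dec w.length w) (arrow i) =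
      dec (w.getD i 0) := fun i => rfl
  have earlier : ∀ (i : Fin w.length) (q : M.carrier × M.carrier), M.rel q.1 q.2 →
      pairKey q < pairKey (dec (w.getD i 0)) →
        ∃ j : Fin w.length, j < i ∧ dec (w.getD j 0) = q := by
    intro i q hq hlt
    obtain ⟨b, hb, rfl⟩ := hdec.exists_eq q hq
    rw [hdec.lt_iff _ hb _ (hget i i.2)] at hlt
    obtain ⟨j, hj, rfl⟩ := hw.exists_lt_getD_eq i.2 (Nat.zero_le _) hlt
    exact ⟨⟨j, hj.trans i.2⟩, hj, rfl⟩
  refine isSRQdig_iff.2 ⟨?_, ?_, ?_⟩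
  · rintro x y (rfl | ⟨h1, h2, h3⟩)
    · exact M.refl _
    · obtain ⟨i, s⟩ := x
      obtain ⟨i', s'⟩ := y
      obtain rfl : i = i' := h1
      obtain rfl : s = false := h2
      obtain rfl : s' = true := h3
      exact hrel i
  · intro q hq
    obtain ⟨b, hb, rfl⟩ := hdec.exists_eq q hq
    obtain ⟨i, hi, rfl⟩ := hw.exists_getD_eq (Nat.zero_le b) hb
    exact ⟨arrow ⟨i, hi⟩, harrow _, hmap _⟩
  · rintro q ⟨x, y⟩ hq hxy hlt
    rcases hxy with hxy | ⟨h1, h2, h3⟩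
    · obtain rfl : x = y := hxy
      obtain ⟨i, s⟩ := x
      have hq12 : q.1 = q.2 := by
        rw [pairKey_lt] at hlt
        rcases hlt with h | h
        · exact h.1
        · exact h.1.2 rfl
      have hle : pairKey (Prod.map (arrowsMap dec w.length w) (arrowsMap dec w.length w)
          ((toLex (i, s), toLex (i, s)) : (arrows w.length).carrier × (arrows w.length).carrier)) ≤
            pairKey (dec (w.getD i 0)) := by
        by_cases hd : (dec (w.getD i 0)).1 = (dec (w.getD i 0)).2
        · refine le_of_eq (congrArg _ ?_)
          cases s
          · exact Prod.ext rfl hd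
          · exact Prod.ext hd.symm rfl
        · refine (pairKey_lt.2 (Or.inl ⟨rfl, hd⟩)).le
      obtain ⟨j, hji, hj⟩ := earlier i q hq (hlt.trans_le hle)
      refine ⟨((arrow j).1, (arrow j).1), Or.inl rfl, ?_,
        pairKey_lt.2 (Or.inr ⟨iff_of_true rfl rfl, Or.inl ?_⟩)⟩
      · rw [← hj] at hq12 ⊢
        exact Prod.ext rfl hq12
      · exact Prod.Lex.lt_iff.2 (Or.inl hji)
    · obtain ⟨i, s⟩ := x
      obtain ⟨i', s'⟩ := y
      obtain rfl : i = i' := h1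
      obtain rfl : s = false := h2
      obtain rfl : s' = true := h3
      change pairKey q < pairKey (Prod.map _ _ (arrow i)) at hlt
      rw [hmap] at hlt
      obtain ⟨j, hji, hj⟩ := earlier i q hq hlt
      refine ⟨arrow j, harrow j, (hmap j).trans hj, pairKey_lt.2 (Or.inr ⟨?_, Or.inl ?_⟩)⟩
      · exact iff_of_false (hne j) (hne i)
      · exact Prod.Lex.lt_iff.2 (Or.inl hji)

/-- A strong rigid quotient map induces a restricted growth word on enumerations. -/
theorem IsSRQdig.exists_rgWord {M N : EDigObj} {p p' : ℕ} {dec : ℕ → M.carrier × M.carrier}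
    {dec' : ℕ → N.carrier × N.carrier} (hdec : IsEnum M p dec) (hdec' : IsEnum N p' dec')
    {f : M.carrier → N.carrier} (hf : IsSRQdig M N f) :
    ∃ g : List ℕ, g.length = p ∧ RGWord 0 g p' ∧
      ∀ i < p, dec' (g.getD i 0) = Prod.map f f (dec i) := by
  obtain ⟨hom, surj, hrig⟩ := isSRQdig_iff.1 hf
  have hex : ∀ i : Fin p, ∃ b < p', dec' b = Prod.map f f (dec i) :=
    fun i => hdec'.exists_eq _ (hom _ _ (hdec.rel i i.2))
  choose b hb hbd using hex
  have hget : ∀ i (hi : i < p), (List.ofFn b).getD i 0 = b ⟨i, hi⟩ := by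
    intro i hi
    rw [List.getD_eq_getElem _ _ (by simpa using hi)]
    simp
  have hinj : ∀ i < p', ∀ j < p', dec' i = dec' j → i = j := by
    intro i hi j hj h
    have h1 := hdec'.lt_iff i hi j hj
    have h2 := hdec'.lt_iff j hj i hi
    rw [h] at h1 h2
    simp only [lt_irrefl, false_iff] at h1 h2
    omega
  refine ⟨List.ofFn b, by simp, RGWord.of_exists (Nat.zero_le _) ?_ ?_ ?_, fun i hi => ?_⟩
  · intro a ha
    obtain ⟨i, rfl⟩ := (List.mem_ofFn' _ _).1 ha
    exact hb i
  · intro a _ ha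
    obtain ⟨q, hq, hqf⟩ := surj _ (hdec'.rel a ha)
    obtain ⟨i, hi, rfl⟩ := hdec.exists_eq q hq
    refine (List.mem_ofFn' _ _).2 ⟨⟨i, hi⟩, hinj _ (hb _) _ ha ?_⟩
    rw [hbd, hqf]
  · intro i hi a _ ha
    have hi : i < p := by simpa using hi
    rw [hget i hi] at ha
    have hap : a < p' := ha.trans (hb _)
    have hlt := (hdec'.lt_iff _ hap _ (hb ⟨i, hi⟩)).2 ha
    rw [hbd] at hlt
    obtain ⟨q, hq, hqf, hqi⟩ := hrig _ _ (hdec'.rel a hap) (hdec.rel i hi) hlt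
    obtain ⟨j, hj, rfl⟩ := hdec.exists_eq q hq
    refine ⟨j, (hdec.lt_iff _ hj _ hi).1 hqi, ?_⟩
    rw [hget j hj]
    exact hinj _ (hb _) _ hap (by rw [hbd, hqf])
  · rw [hget i hi, hbd]

/-- Any class of objects containing all disjoint unions of arrows has the dual Ramsey property. -/
theorem hasDualRamseySub_of_arrows_mem (S : Set EDigObj) (hS : ∀ n, arrows n ∈ S) :
    HasDualRamseySub (fun M : EDigObj => M.carrier) IsSRQdig S := by
  rintro k hk A hA B hB ⟨f₀, hf₀⟩
  by_cases hne : Nonempty A.carrier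
  · have hneB : Nonempty B.carrier := by
      obtain ⟨a⟩ := hne
      obtain ⟨q, -⟩ := (isSRQdig_iff.1 hf₀).2.1 (a, a) (A.refl a)
      exact ⟨q.1⟩
    obtain ⟨p, dec, hdec⟩ := exists_isEnum B
    obtain ⟨p', dec', hdec'⟩ := exists_isEnum A
    obtain ⟨n, hn⟩ := dual_ramsey_rgWord p' p (Fin k)
    refine ⟨arrows n, hS n, fun χ => ?_⟩
    obtain ⟨w, rfl, hw, i, hi⟩ := hn fun v => χ (arrowsMap dec' n v)
    refine ⟨arrowsMap dec w.length w, isSRQdig_arrowsMap hdec hw, i, fun g hg => ?_⟩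
    obtain ⟨v, hvp, hv, hvg⟩ := hg.exists_rgWord hdec hdec'
    rw [← hi v hvp hv]
    congr 1
    funext x
    have hx : w.getD (ofLex x).1 0 < p := by
      rw [List.getD_eq_getElem _ _ (ofLex x).1.2]
      exact hw.lt_of_mem _ (List.getElem_mem _)
    have hplug : (w.map (plug 0 v)).getD (ofLex x).1 0 = v.getD (w.getD (ofLex x).1 0) 0 := by
      rw [List.getD_eq_getElem _ _ (by simp), List.getElem_map,
        List.getD_eq_getElem _ _ (ofLex x).1.2]
      simp [plug]
    simp only [arrowsMap, Function.comp, hplug, hvg _ hx]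
    split_ifs <;> rfl
  · rw [not_nonempty_iff] at hne
    have hB : IsEmpty B.carrier := ⟨fun b => hne.elim (f₀ b)⟩
    refine ⟨B, ‹_›, fun χ => ⟨id, ?_, χ f₀, fun g _ => congrArg χ (funext fun b => hB.elim b)⟩⟩
    exact isSRQdig_iff.2 ⟨fun x => hB.elim x, fun q => hB.elim q.1, fun q => hB.elim q.1⟩

/-- Corollary 5.5. The category `EDig_srq` of finite reflexive
digraphs with linear extensions and strong rigid quotient maps, and its full
subcategory `EPos_srq` of finite posets with linear extensions, have the dual Ramsey
property. -/
theorem stmt14 :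
    HasDualRamseyClass (fun M : EDigObj => M.carrier) IsSRQdig ∧
    HasDualRamseySub (fun M : EDigObj => M.carrier) IsSRQdig
      {M : EDigObj | (∀ x y, M.rel x y → M.rel y x → x = y) ∧
        ∀ x y z, M.rel x y → M.rel y z → M.rel x z} := by
  exact ⟨hasDualRamseySub_of_arrows_mem _ fun _ => trivial,
    hasDualRamseySub_of_arrows_mem _ arrows_isPoset⟩
end
end

section
/- Let r ≥ 2 and let C be a full subcategory of OHgr_srq(r) such that for every finite chain L there is an object in Ob(C) isomorphic to r ⊠ L. Then C has the dual Ramsey property. In particular, the following categories have the dual Ramsey property: OHgr_srq(r) for every r ≥ 2; the category OGra_srq = OHgr_srq(2) of finite linearly ordered reflexive graphs and strong rigid quotient maps of graphs; the full subcategory of OGra_srq spanned by bipartite graphs; and, for every fixed n ≥ 3, the full subcategory of OGra_srq spanned by K_n-free graphs. -/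
open scoped Classical

noncomputable section

/-- The order `⊏_sal` on subsets of a chain: `∅` is least; singletons are compared by
their elements; singletons precede sets of size `> 1`; sets of size `> 1` are compared
by the anti-lexicographic order `⊏_alex`. -/
def finsetSalLT {V : Type*} [LinearOrder V] (X Y : Finset V) : Prop :=
  (X = ∅ ∧ Y ≠ ∅) ∨
    (∃ x y, X = {x} ∧ Y = {y} ∧ x < y) ∨
    ((∃ x, X = {x}) ∧ 1 < Y.card) ∨
    (1 < X.card ∧ 1 < Y.card ∧ altLex X Y)

/-- A finite linearly ordered reflexive `r`-uniform hypergraph: the edge set consists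
of all singletons together with some `r`-element sets. -/
structure OHgrObj (r : ℕ) where
  carrier : Type
  [fintypeI : Fintype carrier]
  [linearOrderI : LinearOrder carrier]
  edges : Set (Finset carrier)
  singleton_mem : ∀ x : carrier, {x} ∈ edges
  card_mem : ∀ e ∈ edges, e.card = 1 ∨ e.card = r

attribute [instance] OHgrObj.fintypeI OHgrObj.linearOrderI

/-- Strong rigid quotient maps of hypergraphs: hypergraph homomorphisms `f` such that
`f̃ : (E,⊏_sal) → (E',⊏'_sal)` is a rigid surjection and `f` is strictly increasing on
every edge on which it is not constant. The morphisms of `OHgr_srq(r)`. -/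
def IsSRQhgr {r : ℕ} (M N : OHgrObj r) (f : M.carrier → N.carrier) : Prop :=
  (∀ e ∈ M.edges, e.image f ∈ N.edges) ∧
    IsRigidSurjOn finsetSalLT finsetSalLT M.edges N.edges (fun e => e.image f) ∧
    ∀ e ∈ M.edges, (¬ ∀ x ∈ e, ∀ y ∈ e, f x = f y) →
      ∀ x ∈ e, ∀ y ∈ e, x < y → f x < f y

/-- The edge set of the hypergraph `r ⊠ L` on `{1,…,r} × L`, ordered
anti-lexicographically (`iℓ ≺ jk` iff `ℓ ⊏ k`, or `ℓ = k` and `i < j`): all singletons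
together with the sets `{1ℓ, …, rℓ}`, `ℓ ∈ L`. -/
def rBoxRel (r : ℕ) (L : Type) [LinearOrder L] : Set (Finset (Lex (L × Fin r))) :=
  {e | (∃ a, e = {a}) ∨
    ∃ x : L, e = Finset.image (fun i : Fin r => toLex (x, i)) Finset.univ}

/-- `ParamWord a b w` : reading `w` from left to right, every letter is either smaller than
the current bound (initially `a`) or equal to it, in which case the bound increases by one;
the final bound is `b`. These are the parameter words over the alphabet `{0, …, a-1}` with
parameters `a, …, b-1` occurring for the first time in increasing order. -/
def ParamWord : ℕ → ℕ → List ℕ → Prop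
  | a, b, [] => a = b
  | a, b, x :: w => (x < a ∧ ParamWord a b w) ∨ (x = a ∧ ParamWord (a + 1) b w)

/-- Substitute the letters of `g` for the parameters `a, a + 1, …` of `f`. -/
def substWord (a : ℕ) (g f : List ℕ) : List ℕ :=
  f.map fun x => if x < a then x else g.getD (x - a) 0

/-- Increase all letters `≥ a` by one. -/
def shiftWord (a : ℕ) (f : List ℕ) : List ℕ :=
  f.map fun x => if x < a then x else x + 1

/-- The part of `w` preceding the first letter `≥ a`. -/
def prefixBelow (a : ℕ) (w : List ℕ) : List ℕ :=
  w.takeWhile fun x => decide (x < a)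

namespace ParamWord

theorem le {w : List ℕ} : ∀ {a b : ℕ}, ParamWord a b w → a ≤ b := by
  induction w with
  | nil => intro a b h; exact Nat.le_of_eq h
  | cons x w ih =>
    rintro a b (⟨_, h⟩ | ⟨_, h⟩)
    · exact ih h
    · have := ih h; omega

theorem append {u v : List ℕ} : ∀ {a b c : ℕ}, ParamWord a b u → ParamWord b c v →
    ParamWord a c (u ++ v) := by
  induction u with
  | nil => intro a b c h h'; cases h; exact h'
  | cons x w ih =>
    rintro a b c (⟨hx, h⟩ | ⟨hx, h⟩) h'
    · exact Or.inl ⟨hx, ih h h'⟩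
    · exact Or.inr ⟨hx, ih h h'⟩

theorem lt_of_mem {w : List ℕ} : ∀ {a b : ℕ}, ParamWord a b w → ∀ x ∈ w, x < b := by
  induction w with
  | nil => simp
  | cons y w ih =>
    rintro a b (⟨hy, h⟩ | ⟨hy, h⟩) x hx
    · rcases List.mem_cons.1 hx with rfl | hx
      · exact hy.trans_le h.le
      · exact ih h x hx
    · rcases List.mem_cons.1 hx with rfl | hx
      · have := h.le; omega
      · exact ih h x hx

theorem of_forall_lt {w : List ℕ} {a : ℕ} (h : ∀ x ∈ w, x < a) : ParamWord a a w := by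
  induction w with
  | nil => rfl
  | cons y w ih =>
    exact Or.inl ⟨h y (by simp), ih fun x hx => h x (by simp [hx])⟩

theorem range' (m : ℕ) : ∀ a : ℕ, ParamWord a (a + m) (List.range' a m) := by
  induction m with
  | zero => intro a; rfl
  | succ m ih =>
    intro a
    rw [List.range'_succ]
    refine Or.inr ⟨rfl, ?_⟩
    have := ih (a + 1)
    rwa [show a + 1 + m = a + (m + 1) by omega] at this

theorem mem_of_le_of_lt {w : List ℕ} : ∀ {a b : ℕ}, ParamWord a b w →
    ∀ x, a ≤ x → x < b → x ∈ w := by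
  induction w with
  | nil => intro a b h x h1 h2; cases h; omega
  | cons y w ih =>
    rintro a b (⟨hy, h⟩ | ⟨hy, h⟩) x h1 h2
    · exact List.mem_cons_of_mem _ (ih h x h1 h2)
    · rcases h1.eq_or_lt with rfl | h1
      · simp [hy]
      · exact List.mem_cons_of_mem _ (ih h x h1 h2)

/-- Every occurrence of a letter is preceded by all smaller parameters. -/
theorem exists_lt_getElem {w : List ℕ} : ∀ {a b : ℕ}, ParamWord a b w →
    ∀ (i : ℕ) (hi : i < w.length) (y : ℕ), a ≤ y → y < w[i] →
      ∃ (j : ℕ) (hj : j < i), w[j]'(hj.trans hi) = y := by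
  induction w with
  | nil => intro a b _ i hi; simp at hi
  | cons x w ih =>
    rintro a b (⟨hx, h⟩ | ⟨hx, h⟩) i hi y h1 h2
    · rcases i with _ | i
      · simp at h2; omega
      · obtain ⟨j, hj, e⟩ := ih h i (by simpa using hi) y h1 (by simpa using h2)
        exact ⟨j + 1, by omega, by simpa using e⟩
    · rcases i with _ | i
      · simp at h2; omega
      · rcases h1.eq_or_lt with rfl | h1
        · exact ⟨0, by omega, by simpa using hx⟩
        obtain ⟨j, hj, e⟩ := ih h i (by simpa using hi) y h1 (by simpa using h2)
        exact ⟨j + 1, by omega, by simpa using e⟩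

theorem of_exists_lt_getElem {w : List ℕ} : ∀ {a b : ℕ}, a ≤ b → (∀ x ∈ w, x < b) →
    (∀ x, a ≤ x → x < b → x ∈ w) →
    (∀ (i : ℕ) (hi : i < w.length) (y : ℕ), a ≤ y → y < w[i] →
      ∃ (j : ℕ) (hj : j < i), w[j]'(hj.trans hi) = y) → ParamWord a b w := by
  induction w with
  | nil =>
    intro a b hab _ h _
    by_contra hne
    have := h a le_rfl (lt_of_le_of_ne hab hne)
    simp at this
  | cons x w ih =>
    intro a b hab hb hs hr
    have hxa : x ≤ a := by
      by_contra hlt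
      obtain ⟨j, hj, -⟩ := hr 0 (by simp) a le_rfl (by simpa using hlt)
      omega
    rcases hxa.lt_or_eq with hx | rfl
    · refine Or.inl ⟨hx, ih hab (fun y hy => hb y (by simp [hy])) (fun y h1 h2 => ?_) ?_⟩
      · rcases List.mem_cons.1 (hs y h1 h2) with rfl | h
        · omega
        · exact h
      · intro i hi y h1 h2
        obtain ⟨j, hj, e⟩ := hr (i + 1) (by simpa using hi) y h1 (by simpa using h2)
        rcases j with _ | j
        · simp at e; omega
        · exact ⟨j, by omega, by simpa using e⟩
    · refine Or.inr ⟨rfl, ih (hb x (by simp)) (fun y hy => hb y (by simp [hy]))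
        (fun y h1 h2 => ?_) ?_⟩
      · rcases List.mem_cons.1 (hs y (by omega) h2) with rfl | h
        · omega
        · exact h
      · intro i hi y h1 h2
        obtain ⟨j, hj, e⟩ := hr (i + 1) (by simpa using hi) y (by omega) (by simpa using h2)
        rcases j with _ | j
        · simp at e; omega
        · exact ⟨j, by omega, by simpa using e⟩

theorem subst_aux {a c : ℕ} {g f : List ℕ} : ∀ {j d : ℕ}, j ≤ g.length →
    ParamWord (a + j) (a + g.length) f → ParamWord a d (g.take j) →
    ParamWord d c (g.drop j) → ParamWord d c (substWord a g f) := by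
  induction f with
  | nil =>
    intro j d _ h _ h2
    have : j = g.length := by have : a + j = a + g.length := h; omega
    subst this
    simpa [substWord] using h2
  | cons x f ih =>
    rintro j d hj (⟨hx, h⟩ | ⟨hx, h⟩) h1 h2
    · refine Or.inl ⟨?_, ih hj h h1 h2⟩
      have had := h1.le
      simp only
      split_ifs with hxa
      · omega
      · have hlt : x - a < g.length := by omega
        rw [List.getD_eq_getElem _ _ hlt]
        exact h1.lt_of_mem _ (List.mem_take_iff_getElem.2 ⟨x - a, by omega, rfl⟩)
    · have hjl : j < g.length := by have := h.le; omega
      have hd : g.drop j = g[j] :: g.drop (j + 1) := List.drop_eq_getElem_cons hjl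
      have ht : g.take (j + 1) = g.take j ++ [g[j]] := (List.take_concat_get' g j hjl).symm
      have hl : (if x < a then x else g.getD (x - a) 0) = g[j] := by
        rw [if_neg (by omega), show x - a = j by omega, List.getD_eq_getElem _ _ hjl]
      rw [hd] at h2
      rw [add_assoc] at h
      change (_ ∧ ParamWord d c (substWord a g f)) ∨ (_ ∧ ParamWord (d + 1) c (substWord a g f))
      simp only [hl]
      rcases h2 with ⟨hy, h2⟩ | ⟨hy, h2⟩
      · exact Or.inl ⟨hy, ih hjl h (ht ▸ h1.append (Or.inl ⟨hy, rfl⟩)) h2⟩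
      · exact Or.inr ⟨hy, ih hjl h (ht ▸ h1.append (Or.inr ⟨hy, rfl⟩)) h2⟩

/-- Parameter words are closed under substitution. -/
theorem subst {a c : ℕ} {g f : List ℕ} (hf : ParamWord a (a + g.length) f)
    (hg : ParamWord a c g) : ParamWord a c (substWord a g f) :=
  subst_aux (j := 0) (Nat.zero_le _) hf rfl hg

theorem shift_aux {a : ℕ} {f : List ℕ} : ∀ {c b : ℕ}, a ≤ c → ParamWord c b f →
    ParamWord (c + 1) (b + 1) (shiftWord a f) := by
  induction f with
  | nil => intro c b _ h; cases h; rfl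
  | cons x f ih =>
    rintro c b hac (⟨hx, h⟩ | ⟨hx, h⟩)
    · refine Or.inl ⟨?_, ih hac h⟩
      simp only
      split_ifs <;> omega
    · refine Or.inr ⟨?_, ih (by omega) h⟩
      simp only
      split_ifs <;> omega

theorem shift {a b : ℕ} {f : List ℕ} (h : ParamWord a b f) :
    ParamWord (a + 1) (b + 1) (shiftWord a f) :=
  shift_aux le_rfl h

end ParamWord

@[simp] theorem length_substWord (a : ℕ) (g f : List ℕ) :
    (substWord a g f).length = f.length := by
  simp [substWord]

@[simp] theorem length_shiftWord (a : ℕ) (f : List ℕ) : (shiftWord a f).length = f.length := by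
  simp [shiftWord]

theorem getElem_substWord (a : ℕ) (g f : List ℕ) {i : ℕ} (hi : i < f.length) :
    (substWord a g f)[i]'(by simpa using hi) =
      if f[i] < a then f[i] else g.getD (f[i] - a) 0 := by
  simp [substWord]

theorem substWord_append (a : ℕ) (g u v : List ℕ) :
    substWord a g (u ++ v) = substWord a g u ++ substWord a g v := by
  simp [substWord]

theorem substWord_substWord {a : ℕ} {g f₁ f₂ : List ℕ} (h : ∀ x ∈ f₁, x < a + f₂.length) :
    substWord a g (substWord a f₂ f₁) = substWord a (substWord a g f₂) f₁ := by
  simp only [substWord, List.map_map]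
  refine List.map_congr_left fun x hx => ?_
  have := h x hx
  simp only [Function.comp]
  by_cases hxa : x < a
  · simp [hxa]
  · have hlt : x - a < f₂.length := by omega
    simp [hxa, hlt, List.getD_eq_getElem?_getD]

theorem substWord_cons_shiftWord (a x : ℕ) (u f : List ℕ) :
    substWord a (x :: u) (shiftWord a f) = substWord a u f := by
  simp only [substWord, shiftWord, List.map_map]
  refine List.map_congr_left fun y _ => ?_
  simp only [Function.comp]
  by_cases hy : y < a
  · simp [hy]
  · rw [if_neg hy, if_neg (by omega), if_neg hy, show y + 1 - a = (y - a) + 1 by omega,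
      List.getD_cons_succ]

theorem substWord_cons_self (a : ℕ) (h f : List ℕ) :
    substWord a (a :: h) f = substWord (a + 1) h f := by
  refine List.map_congr_left fun y _ => ?_
  rcases lt_trichotomy y a with hy | rfl | hy
  · rw [if_pos hy, if_pos (by omega)]
  · simp
  · rw [if_neg (by omega), if_neg (by omega), show y - a = (y - (a + 1)) + 1 by omega,
      List.getD_cons_succ]

theorem substWord_cons_substWord_succ {a x : ℕ} {u f₁ f₂ : List ℕ}
    (h : ∀ y ∈ f₁, y < a + 1 + f₂.length) :
    substWord a (x :: u) (substWord (a + 1) (shiftWord a f₂) f₁) =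
      substWord a (x :: substWord a u f₂) f₁ := by
  rw [← substWord_cons_shiftWord a x u f₂, ← substWord_cons_self,
    substWord_substWord (by simpa [add_assoc, add_comm 1] using h)]
  congr 1
  simp [substWord]

theorem prefixBelow_cons_of_lt {a x : ℕ} (hx : x < a) (w : List ℕ) :
    prefixBelow a (x :: w) = x :: prefixBelow a w := by
  simp [prefixBelow, hx]

theorem prefixBelow_cons_of_le {a x : ℕ} (hx : a ≤ x) (w : List ℕ) :
    prefixBelow a (x :: w) = [] := by
  simp [prefixBelow, hx]

theorem prefixBelow_append_of_forall {a : ℕ} {u : List ℕ} (h : ∀ x ∈ u, x < a) (v : List ℕ) :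
    prefixBelow a (u ++ v) = u ++ prefixBelow a v :=
  List.takeWhile_append_of_pos (by simpa using h)

theorem prefixBelow_append_of_mem {a x : ℕ} {u : List ℕ} (hx : x ∈ u) (hax : a ≤ x)
    (v : List ℕ) : prefixBelow a (u ++ v) = prefixBelow a u := by
  induction u with
  | nil => simp at hx
  | cons y u ih =>
    by_cases hy : y < a
    · rw [List.cons_append, prefixBelow_cons_of_lt hy, prefixBelow_cons_of_lt hy, ih]
      rcases List.mem_cons.1 hx with rfl | h
      · omega
      · exact h
    · rw [List.cons_append, prefixBelow_cons_of_le (not_lt.1 hy),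
        prefixBelow_cons_of_le (not_lt.1 hy)]

theorem lt_of_mem_prefixBelow {a x : ℕ} {w : List ℕ} (hx : x ∈ prefixBelow a w) : x < a := by
  simpa using List.mem_takeWhile_imp hx

theorem length_prefixBelow_le (a : ℕ) (w : List ℕ) : (prefixBelow a w).length ≤ w.length :=
  (List.takeWhile_prefix _).length_le

theorem exists_getElem_prefixBelow {a x : ℕ} {w : List ℕ} (hx : x ∈ w) (hax : a ≤ x) :
    ∃ h : (prefixBelow a w).length < w.length, a ≤ w[(prefixBelow a w).length] := by
  induction w with
  | nil => simp at hx
  | cons y w ih =>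
    by_cases hy : y < a
    · have hx' : x ∈ w := by
        rcases List.mem_cons.1 hx with rfl | h
        · omega
        · exact h
      obtain ⟨h1, h2⟩ := ih hx'
      simp only [prefixBelow_cons_of_lt hy]
      exact ⟨by simpa using h1, by simpa using h2⟩
    · simp only [prefixBelow_cons_of_le (not_lt.1 hy)]
      exact ⟨by simp, by simpa using hy⟩

/-- The Hales–Jewett theorem for parameter words. -/
theorem exists_paramWord_mono_const (a m : ℕ) (κ : Type) [Finite κ] :
    ∃ n : ℕ, ∀ χ : List ℕ → κ, ∃ f : List ℕ, f.length = n ∧ ParamWord a (a + m) f ∧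
      ∃ c : κ, ∀ g : List ℕ, ParamWord a a g → g.length = m → χ (substWord a g f) = c := by
  obtain ⟨ι, _, hι⟩ := Combinatorics.Line.exists_mono_in_high_dimension (Fin m → Fin a) κ
  let L : List ι := (Finset.univ : Finset ι).toList
  let block : (Fin m → Fin a) → List ℕ := fun w => List.ofFn fun j => (w j : ℕ)
  have block_lt : ∀ w, ∀ x ∈ block w, x < a := by
    intro w x hx
    obtain ⟨j, rfl⟩ := List.mem_ofFn.1 hx
    exact (w j).2
  refine ⟨L.length * m, fun χ => ?_⟩
  obtain ⟨l, c, hl⟩ := hι fun x => χ (L.flatMap fun i => block (x i))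
  let piece : ι → List ℕ := fun i => (l.idxFun i).elim (List.range' a m) block
  have piece_length : ∀ i, (piece i).length = m := by
    intro i
    cases h : l.idxFun i <;> simp [piece, block, h]
  have piece_lt : ∀ i, ∀ x ∈ piece i, x < a + m := by
    intro i x hx
    cases h : l.idxFun i with
    | none => simp [piece, h] at hx; omega
    | some w =>
      have := block_lt w x (by simpa [piece, h] using hx)
      omega
  have param : ∀ L' : List ι, (∃ i ∈ L', l.idxFun i = none) →
      ParamWord a (a + m) (L'.flatMap piece) := by
    intro L'
    induction L' with
    | nil => simp
    | cons i L' ih =>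
      intro hi
      rw [List.flatMap_cons]
      cases h : l.idxFun i with
      | none =>
        refine ParamWord.append (b := a + m) ?_ (ParamWord.of_forall_lt fun x hx => ?_)
        · simpa [piece, h] using ParamWord.range' m a
        · obtain ⟨j, -, hj⟩ := List.mem_flatMap.1 hx
          exact piece_lt j x hj
      | some w =>
        refine ParamWord.append (b := a) (ParamWord.of_forall_lt ?_) (ih ?_)
        · simpa [piece, h] using block_lt w
        · obtain ⟨j, hj, e⟩ := hi
          rcases List.mem_cons.1 hj with rfl | hj
          · simp [h] at e
          · exact ⟨j, hj, e⟩
  refine ⟨L.flatMap piece, ?_, param L ?_, c, fun g hg hgm => ?_⟩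
  · simp [List.length_flatMap, piece_length]
  · obtain ⟨i, hi⟩ := l.proper
    exact ⟨i, by simp [L], hi⟩
  · have hlt := hg.lt_of_mem
    let x : Fin m → Fin a := fun j => ⟨g[j], hlt _ (List.getElem_mem _)⟩
    have hx : block x = g := by
      apply List.ext_getElem
      · simp [block, hgm]
      · intro i _ _
        simp [block, x]
    rw [← hl x]
    congr 1
    rw [substWord, List.map_flatMap]
    congr 1
    funext i
    change substWord a g (piece i) = _
    rw [Combinatorics.Line.apply_def]
    cases h : l.idxFun i with
    | none =>
      simp only [piece, h, Option.elim_none, Option.getD_none, hx]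
      apply List.ext_getElem
      · simp [hgm]
      · intro i h1 h2
        simp [substWord, h2]
    | some w =>
      simp only [piece, h, Option.elim_some, Option.getD_some]
      exact (List.map_congr_left fun y hy => if_pos (block_lt w y hy)).trans (List.map_id _)

/-- A coloring of finite words can be made to depend on the length only on the prefixes
preceding the first parameter. -/
theorem exists_paramWord_prefix_length (a M : ℕ) : ∀ (κ : Type) [Finite κ],
    ∃ n : ℕ, ∀ ψ : List ℕ → κ, ∃ f : List ℕ, f.length = n ∧ ParamWord a (a + M) f ∧
      ∃ ρ : ℕ → κ, ∀ (b : ℕ) (g : List ℕ), a < b → ParamWord a b g → g.length = M →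
        ψ (prefixBelow a (substWord a g f)) = ρ (prefixBelow a g).length := by
  induction M with
  | zero =>
    intro κ _
    refine ⟨0, fun ψ => ⟨[], rfl, rfl, fun _ => ψ [], fun b g hb hg hM => ?_⟩⟩
    rw [List.length_eq_zero_iff] at hM
    subst hM
    exact absurd hg hb.ne
  | succ M ih =>
    intro κ _
    obtain ⟨n, hn⟩ := ih κ
    have : Finite {u : List (Fin a) // u.length ≤ n} := (List.finite_length_le (Fin a) n).to_subtype
    obtain ⟨N, hN⟩ := exists_paramWord_mono_const a 1 ({u : List (Fin a) // u.length ≤ n} → κ)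
    refine ⟨N + n, fun ψ => ?_⟩
    obtain ⟨v, hvN, hv, C, hC⟩ := hN fun s u => ψ (s ++ u.1.map Fin.val)
    obtain ⟨f, hfn, hf, ρ, hρ⟩ := hn fun u => if h : ∃ u' : {u : List (Fin a) // u.length ≤ n},
      u'.1.map Fin.val = u then C h.choose else ψ u
    refine ⟨v ++ shiftWord a f, by simp [hvN, hfn], ?_,
      fun j => Nat.casesOn j (ψ (prefixBelow a (substWord a [a] v))) ρ, fun b g hb hg hM => ?_⟩
    · have := hf.shift
      rw [show a + M + 1 = a + (M + 1) by omega] at this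
      exact hv.append this
    rcases g with _ | ⟨x, g⟩
    · simp at hM
    rw [substWord_append]
    have hsub : substWord a (x :: g) v = substWord a [x] v := by
      refine List.map_congr_left fun y hy => ?_
      have := hv.lt_of_mem y hy
      by_cases hya : y < a
      · simp [hya]
      · simp [show y = a by omega]
    rw [hsub]
    rcases hg with ⟨hx, hg⟩ | ⟨rfl, hg⟩
    · have hxv : ∀ y ∈ substWord a [x] v, y < a :=
        (ParamWord.subst (g := [x]) hv (Or.inl ⟨hx, rfl⟩)).lt_of_mem
      have key : ∀ u : List ℕ, u.length ≤ n → (∀ y ∈ u, y < a) →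
          ψ (substWord a [x] v ++ u) =
            if h : ∃ u' : {u : List (Fin a) // u.length ≤ n},
              u'.1.map Fin.val = u then C h.choose else ψ u := by
        intro u hu hua
        have h : ∃ u' : {u : List (Fin a) // u.length ≤ n}, u'.1.map Fin.val = u := by
          refine ⟨⟨u.pmap Fin.mk hua, by simpa using hu⟩, ?_⟩
          simp [List.map_pmap]
        rw [dif_pos h, ← hC [x] (Or.inl ⟨hx, rfl⟩) rfl]
        simp only [h.choose_spec]
      rw [substWord_cons_shiftWord, prefixBelow_append_of_forall hxv, key,
        hρ b g hb hg (by simpa using hM), prefixBelow_cons_of_lt hx]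
      · rfl
      · exact (length_prefixBelow_le _ _).trans (by simp [hfn])
      · exact fun y hy => lt_of_mem_prefixBelow hy
    · rw [prefixBelow_append_of_mem (x := x), prefixBelow_cons_of_le le_rfl]
      · rfl
      · exact (ParamWord.subst (g := [x]) hv (Or.inr ⟨rfl, rfl⟩)).mem_of_le_of_lt x le_rfl
          (Nat.lt_succ_self x)
      · exact le_rfl

theorem exists_paramWord_forall_getElem {κ : Type} (a : ℕ) (ha : 0 < a) (c : κ) (L : ℕ) :
    ∀ (b m : ℕ) (ρ : ℕ → κ), m ≤ Nat.count (fun i => ρ i = c) L →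
      ∃ q : List ℕ, q.length = L ∧ ParamWord (a + b) (a + b + m) q ∧
        ∀ (i : ℕ) (hi : i < q.length), a ≤ q[i] → ρ i = c := by
  induction L with
  | zero =>
    intro b m ρ h
    obtain rfl : m = 0 := by simpa using h
    exact ⟨[], rfl, rfl, by simp⟩
  | succ L ih =>
    intro b m ρ h
    rw [Nat.count_succ'] at h
    by_cases hc : 0 < m ∧ ρ 0 = c
    · rw [if_pos hc.2] at h
      obtain ⟨q, hq, hp, hρ⟩ := ih (b + 1) (m - 1) (fun i => ρ (i + 1)) (by omega)
      refine ⟨(a + b) :: q, by simp [hq], Or.inr ⟨rfl, ?_⟩, ?_⟩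
      · rwa [show a + (b + 1) + (m - 1) = a + b + m by omega] at hp
      · rintro (_ | i) hi h
        · exact hc.2
        · exact hρ i (by simpa using hi) (by simpa using h)
    · have hm : m ≤ Nat.count (fun i => ρ (i + 1) = c) L := by
        split_ifs at h with h0
        · have : m = 0 := by
            by_contra hm
            exact hc ⟨Nat.pos_of_ne_zero hm, h0⟩
          omega
        · exact h
      obtain ⟨q, hq, hp, hρ⟩ := ih b m (fun i => ρ (i + 1)) hm
      refine ⟨0 :: q, by simp [hq], Or.inl ⟨by omega, hp⟩, ?_⟩
      rintro (_ | i) hi h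
      · simp at h; omega
      · exact hρ i (by simpa using hi) (by simpa using h)

/-- A coloring of the positions of the first parameter can be made constant. -/
theorem exists_paramWord_position_mono (a m : ℕ) (κ : Type) [Finite κ] :
    ∃ M : ℕ, ∀ ρ : ℕ → κ, ∃ q : List ℕ, q.length = M ∧ ParamWord a (a + m) q ∧
      ∃ c : κ, ∀ (b : ℕ) (g : List ℕ), a < b → ParamWord a b g → g.length = m →
        ρ (prefixBelow a (substWord a g q)).length = c := by
  rcases Nat.eq_zero_or_pos a with rfl | ha
  · refine ⟨m, fun ρ => ⟨List.range' 0 m, by simp, ParamWord.range' m 0, ρ 0,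
      fun b g _ _ _ => ?_⟩⟩
    congr
    rw [List.length_eq_zero_iff, List.eq_nil_iff_forall_not_mem]
    exact fun x hx => absurd (lt_of_mem_prefixBelow hx) (Nat.not_lt_zero x)
  · have := Fintype.ofFinite κ
    refine ⟨Fintype.card κ * m, fun ρ => ?_⟩
    have : Nonempty κ := ⟨ρ 0⟩
    obtain ⟨c, -, hc⟩ := Finset.exists_le_card_fiber_of_mul_le_card_of_maps_to
      (s := Finset.range (Fintype.card κ * m)) (t := (Finset.univ : Finset κ)) (f := ρ) (n := m)
      (by simp) Finset.univ_nonempty (by simp)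
    rw [← Nat.count_eq_card_filter_range] at hc
    obtain ⟨q, hq, hp, hρ⟩ := exists_paramWord_forall_getElem a ha c _ 0 m ρ hc
    refine ⟨q, hq, hp, c, fun b g hb hg hm => ?_⟩
    have hgq : ParamWord a b (substWord a g q) := ParamWord.subst (by rw [hm]; exact hp) hg
    obtain ⟨h1, h2⟩ := exists_getElem_prefixBelow (hgq.mem_of_le_of_lt a le_rfl hb) le_rfl
    refine hρ _ (by simpa using h1) ?_
    by_contra hlt
    rw [getElem_substWord _ _ _ (by simpa using h1), if_pos (not_le.1 hlt)] at h2
    exact hlt h2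

/-- Inductive step of the dual Ramsey theorem: a coloring can be made to depend only on the
prefix preceding the first parameter. -/
theorem exists_paramWord_depends_prefix (k : ℕ)
    (ih : ∀ (a m : ℕ) (κ : Type) [Finite κ], ∃ n : ℕ, ∀ χ : List ℕ → κ, ∃ f : List ℕ,
      f.length = n ∧ ParamWord a (a + m) f ∧ ∃ c : κ, ∀ g : List ℕ, ParamWord a (a + k) g →
        g.length = m → χ (substWord a g f) = c) (a M : ℕ) : ∀ (κ : Type) [Finite κ],
    ∃ n : ℕ, ∀ χ : List ℕ → κ, ∃ f : List ℕ, f.length = n ∧ ParamWord a (a + M) f ∧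
      ∃ ψ : List ℕ → κ, ∀ g : List ℕ, ParamWord a (a + (k + 1)) g → g.length = M →
        χ (substWord a g f) = ψ (prefixBelow a g) := by
  induction M with
  | zero =>
    intro κ _
    refine ⟨0, fun χ => ⟨[], rfl, rfl, fun _ => χ [], fun g hg hM => ?_⟩⟩
    rw [List.length_eq_zero_iff] at hM
    subst hM
    exact absurd hg (by simp [ParamWord])
  | succ M ihM =>
    intro κ _
    obtain ⟨m', hm'⟩ := ihM (Fin a → κ)
    obtain ⟨n', hn'⟩ := ih (a + 1) m' κ
    refine ⟨n' + 1, fun χ => ?_⟩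
    obtain ⟨f₁, hf₁n, hf₁, c, hc⟩ := hn' fun u => χ (a :: u)
    obtain ⟨f₂, hf₂n, hf₂, ψ, hψ⟩ := hm' fun u x => χ (x :: substWord a (x :: u) f₁)
    have hs := hf₂.shift
    have hlt : ∀ y ∈ f₁, y < a + 1 + f₂.length := by rw [hf₂n]; exact hf₁.lt_of_mem
    refine ⟨a :: substWord (a + 1) (shiftWord a f₂) f₁, by simp [hf₁n], Or.inr ⟨rfl, ?_⟩,
      fun p => match p with
        | [] => c
        | x :: p => if h : x < a then ψ p ⟨x, h⟩ else c, fun g hg hM => ?_⟩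
    · rw [show a + (M + 1) = a + M + 1 by omega]
      exact ParamWord.subst (by simpa [hf₂n] using hf₁) hs
    rcases g with _ | ⟨x, g⟩
    · simp at hM
    have hgM : g.length = M := by simpa using hM
    have hcons : ∀ f, substWord a (x :: g) (a :: f) = x :: substWord a (x :: g) f := by
      intro f; simp [substWord]
    rw [hcons]
    rcases hg with ⟨hx, hg⟩ | ⟨rfl, hg⟩
    · rw [substWord_cons_substWord_succ hlt, prefixBelow_cons_of_lt hx]
      simp only [dif_pos hx]
      rw [← hψ g hg hgM]
    · rw [substWord_cons_self, substWord_substWord (by simpa using hlt),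
        prefixBelow_cons_of_le le_rfl]
      refine hc _ (ParamWord.subst ?_ ?_) (by simp [hf₂n])
      · rw [hgM, show x + 1 + M = x + M + 1 by omega]; exact hs
      · rwa [show x + 1 + k = x + (k + 1) by omega]

/-- The Graham–Rothschild theorem (dual Ramsey theorem) for parameter words. -/
theorem exists_paramWord_mono (k : ℕ) : ∀ (a m : ℕ) (κ : Type) [Finite κ],
    ∃ n : ℕ, ∀ χ : List ℕ → κ, ∃ f : List ℕ, f.length = n ∧ ParamWord a (a + m) f ∧
      ∃ c : κ, ∀ g : List ℕ, ParamWord a (a + k) g → g.length = m →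
        χ (substWord a g f) = c := by
  induction k with
  | zero => exact fun a m κ _ => exists_paramWord_mono_const a m κ
  | succ k ih =>
    intro a m κ _
    obtain ⟨M, hM⟩ := exists_paramWord_position_mono a m κ
    obtain ⟨M₂, hM₂⟩ := exists_paramWord_prefix_length a M κ
    obtain ⟨n, hn⟩ := exists_paramWord_depends_prefix k ih a M₂ κ
    refine ⟨n, fun χ => ?_⟩
    obtain ⟨f₁, hf₁n, hf₁, ψ, hψ⟩ := hn χ
    obtain ⟨f₂, hf₂n, hf₂, ρ, hρ⟩ := hM₂ ψ
    obtain ⟨q, hqM, hq, c, hc⟩ := hM ρ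
    have hq₂ : ParamWord a (a + m) (substWord a q f₂) :=
      ParamWord.subst (by rw [hqM]; exact hf₂) hq
    refine ⟨substWord a (substWord a q f₂) f₁, by simp [hf₁n],
      ParamWord.subst (by simpa [hf₂n] using hf₁) hq₂, c, fun g hg hgm => ?_⟩
    have hgq : ParamWord a (a + (k + 1)) (substWord a g q) :=
      ParamWord.subst (by rw [hgm]; exact hq) hg
    have hgf : ParamWord a (a + (k + 1)) (substWord a (substWord a g q) f₂) :=
      ParamWord.subst (by simpa [hqM] using hf₂) hgq
    rw [substWord_substWord (by simpa [hf₂n] using hf₁.lt_of_mem),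
      substWord_substWord (by rw [hqM]; exact hf₂.lt_of_mem), hψ _ hgf (by simp [hf₂n]),
      hρ _ _ (by omega) hgq (by simp [hqM]), hc _ g (by omega) hg hgm]

theorem altLex_iff_toColex_lt {V : Type*} [LinearOrder V] (X Y : Finset V) :
    altLex X Y ↔ toColex X < toColex Y := by
  rw [Finset.Colex.toColex_lt_toColex_iff_exists_forall_lt]
  constructor
  · rintro ⟨m, hY, hX, h⟩
    refine ⟨m, hY, hX, fun b hbX hbY => ?_⟩
    rcases lt_trichotomy b m with hb | rfl | hb
    · exact hb
    · exact absurd hY hbY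
    · exact absurd ((h b hb).1 hbX) hbY
  · rintro ⟨a, haY, haX, h⟩
    have hne : (Y \ X).Nonempty := ⟨a, Finset.mem_sdiff.2 ⟨haY, haX⟩⟩
    obtain ⟨h1, h2⟩ := Finset.mem_sdiff.1 ((Y \ X).max'_mem hne)
    refine ⟨(Y \ X).max' hne, h1, h2, fun z hz => ⟨fun hzX => ?_, fun hzY => ?_⟩⟩
    · by_contra hzY
      have h3 := h z hzX hzY
      have h4 := (Y \ X).le_max' a (Finset.mem_sdiff.2 ⟨haY, haX⟩)
      exact absurd (h3.trans_le h4) (not_lt.2 hz.le)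
    · by_contra hzX
      exact absurd ((Y \ X).le_max' z (Finset.mem_sdiff.2 ⟨hzY, hzX⟩)) (not_le.2 hz)

/-- The order `⊏_sal` on nonempty sets is the pullback of a linear order along this key. -/
def salKey {V : Type*} [LinearOrder V] (X : Finset V) : Bool ×ₗ Colex (Finset V) :=
  toLex (decide (1 < X.card), toColex X)

theorem salKey_injective {V : Type*} [LinearOrder V] :
    Function.Injective (salKey : Finset V → _) := by
  intro X Y h
  have := congrArg (fun z => (ofLex z).2) h
  exact toColex_inj.1 this

theorem finsetSalLT_iff {V : Type*} [LinearOrder V] {X Y : Finset V} (hX : X.Nonempty)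
    (hY : Y.Nonempty) : finsetSalLT X Y ↔ salKey X < salKey Y := by
  have hsingle : ∀ {Z : Finset V}, Z.Nonempty → ¬ 1 < Z.card → ∃ z, Z = {z} := by
    intro Z hZ h
    exact Finset.card_eq_one.1 (le_antisymm (not_lt.1 h) hZ.card_pos)
  unfold finsetSalLT salKey
  rw [Prod.Lex.toLex_lt_toLex, ← altLex_iff_toColex_lt]
  by_cases h1 : 1 < X.card <;> by_cases h2 : 1 < Y.card
  · have h3 : ∀ x, X ≠ {x} := by rintro x rfl; simp at h1
    simp [h1, h2, h3, hX.ne_empty]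
  · obtain ⟨y, rfl⟩ := hsingle hY h2
    have h3 : ∀ x, X ≠ {x} := by rintro x rfl; simp at h1
    simp [h1, h3, hX.ne_empty]
  · obtain ⟨x, rfl⟩ := hsingle hX h1
    simp [h2]
  · obtain ⟨x, rfl⟩ := hsingle hX h1
    obtain ⟨y, rfl⟩ := hsingle hY h2
    simp [altLex_iff_toColex_lt, Finset.Colex.singleton_lt_singleton]

namespace OHgrObj

variable {r : ℕ}

theorem nonempty_of_mem_edges (hr : 2 ≤ r) (M : OHgrObj r) {e : Finset M.carrier}
    (he : e ∈ M.edges) : e.Nonempty := by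
  rw [← Finset.card_pos]
  rcases M.card_mem e he with h | h <;> omega

/-- The increasing enumeration of the edges with respect to `⊏_sal`. -/
theorem exists_edge_enumeration (hr : 2 ≤ r) (M : OHgrObj r) :
    ∃ (p : ℕ) (ε : Fin p ≃ M.edges), ∀ i j, finsetSalLT (ε i).1 (ε j).1 ↔ i < j := by
  have : Finite M.edges := inferInstance
  have := Fintype.ofFinite M.edges
  let inst : LinearOrder M.edges :=
    LinearOrder.lift' (fun e => salKey e.1) (salKey_injective.comp Subtype.val_injective)
  let φ := Fintype.orderIsoFinOfCardEq M.edges rfl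
  refine ⟨Fintype.card M.edges, φ.toEquiv, fun i j => ?_⟩
  rw [finsetSalLT_iff (nonempty_of_mem_edges hr M (Subtype.coe_prop _))
    (nonempty_of_mem_edges hr M (Subtype.coe_prop _)), ← not_le, ← not_le]
  exact not_congr φ.map_rel_iff'

end OHgrObj

section Transfer

variable {r : ℕ}

theorem IsSRQhgr.exists_salLT (hr : 2 ≤ r) {M N : OHgrObj r} {g : M.carrier → N.carrier}
    (hg : IsSRQhgr M N g) {e : Finset M.carrier} (he : e ∈ M.edges) {x : Finset N.carrier}
    (hx : x ∈ N.edges) (h : finsetSalLT x (e.image g)) :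
    ∃ e' ∈ M.edges, finsetSalLT e' e ∧ e'.image g = x := by
  obtain ⟨hhom, ⟨-, hsurj, hrig⟩, -⟩ := hg
  have hmin : ∀ y ∈ N.edges, ∃ m, MinWrt finsetSalLT {u | u ∈ M.edges ∧ u.image g = y} m := by
    intro y hy
    obtain ⟨m, hm, hle⟩ := Set.exists_min_image {u | u ∈ M.edges ∧ u.image g = y} salKey
      (Set.toFinite _) (by obtain ⟨a, h1, h2⟩ := hsurj y hy; exact ⟨a, h1, h2⟩)
    refine ⟨m, hm, fun u hu => ?_⟩
    rcases (hle u hu).eq_or_lt with h | h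
    · exact Or.inl (salKey_injective h.symm)
    · exact Or.inr ((finsetSalLT_iff (M.nonempty_of_mem_edges hr hm.1)
        (M.nonempty_of_mem_edges hr hu.1)).2 h)
  obtain ⟨a, ha⟩ := hmin x hx
  obtain ⟨b, hb⟩ := hmin _ (hhom e he)
  have hab := hrig x hx _ (hhom e he) h a b ha hb
  refine ⟨a, ha.1.1, ?_, ha.1.2⟩
  rcases hb.2 e ⟨he, rfl⟩ with rfl | hbe
  · exact hab
  · have hne : ∀ {u}, u ∈ M.edges → u.Nonempty := M.nonempty_of_mem_edges hr
    rw [finsetSalLT_iff (hne ha.1.1) (hne hb.1.1)] at hab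
    rw [finsetSalLT_iff (hne hb.1.1) (hne he)] at hbe
    exact (finsetSalLT_iff (hne ha.1.1) (hne he)).2 (hab.trans hbe)

/-- Via enumerations of the edges, strong rigid quotient maps yield parameter words. -/
theorem IsSRQhgr.paramWord (hr : 2 ≤ r) {M N : OHgrObj r} {g : M.carrier → N.carrier}
    (hg : IsSRQhgr M N g) {p q : ℕ} (εN : Fin p ≃ N.edges) (εM : Fin q ≃ M.edges)
    (hN : ∀ i j, finsetSalLT (εN i).1 (εN j).1 ↔ i < j)
    (hM : ∀ i j, finsetSalLT (εM i).1 (εM j).1 ↔ i < j) :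
    ParamWord 0 p (List.ofFn fun i : Fin q =>
      (εN.symm ⟨(εM i).1.image g, hg.1 _ (εM i).2⟩ : ℕ)) := by
  refine ParamWord.of_exists_lt_getElem (Nat.zero_le _) ?_ ?_ ?_
  · intro x hx
    obtain ⟨i, rfl⟩ := List.mem_ofFn.1 hx
    exact Fin.is_lt _
  · intro x _ hx
    obtain ⟨e, he, hex⟩ := hg.2.1.2.1 _ (εN ⟨x, hx⟩).2
    refine List.mem_ofFn.2 ⟨εM.symm ⟨e, he⟩, ?_⟩
    have : (⟨e.image g, hg.1 _ he⟩ : N.edges) = εN ⟨x, hx⟩ := Subtype.ext hex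
    simp [this]
  · intro i hi y _ hy
    simp only [List.length_ofFn] at hi
    simp only [List.getElem_ofFn] at hy ⊢
    have hyp : y < p := hy.trans (Fin.is_lt _)
    have h1 := (hN ⟨y, hyp⟩ (εN.symm ⟨(εM ⟨i, hi⟩).1.image g, hg.1 _ (εM ⟨i, hi⟩).2⟩)).2 hy
    rw [Equiv.apply_symm_apply] at h1
    obtain ⟨e', he', hlt, hex⟩ := hg.exists_salLT hr (εM ⟨i, hi⟩).2 (εN ⟨y, hyp⟩).2 h1
    have h2 := hM (εM.symm ⟨e', he'⟩) ⟨i, hi⟩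
    rw [Equiv.apply_symm_apply] at h2
    refine ⟨_, h2.1 hlt, ?_⟩
    have : (⟨e'.image g, hg.1 _ he'⟩ : N.edges) = εN ⟨y, hyp⟩ := Subtype.ext hex
    simp [this]

/-- The `i`-th smallest element of a set of size `r`; the only element of a singleton. -/
def edgeNth {V : Type*} [LinearOrder V] [Nonempty V] (r : ℕ) (X : Finset V) (i : Fin r) : V :=
  if h : X.card = r then X.orderEmbOfFin h i
  else if h : X.Nonempty then X.min' h else Classical.arbitrary V

theorem strictMono_edgeNth {V : Type*} [LinearOrder V] [Nonempty V] {X : Finset V}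
    (h : X.card = r) : StrictMono (edgeNth r X) := by
  intro i j hij
  simpa [edgeNth, h] using hij

theorem edgeNth_singleton {V : Type*} [LinearOrder V] [Nonempty V] (hr : 2 ≤ r) (v : V)
    (i : Fin r) : edgeNth r {v} i = v := by
  have : ¬ (1 = r) := by omega
  simp [edgeNth, this]

theorem image_edgeNth {V : Type*} [LinearOrder V] [Nonempty V] (hr : 2 ≤ r) {X : Finset V}
    (h : X.card = 1 ∨ X.card = r) : Finset.univ.image (edgeNth r X) = X := by
  rcases h with h | h
  · obtain ⟨v, rfl⟩ := Finset.card_eq_one.1 h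
    ext z
    have : Nonempty (Fin r) := ⟨⟨0, by omega⟩⟩
    simp [edgeNth_singleton hr, eq_comm]
  · ext z
    simp only [Finset.mem_image, Finset.mem_univ, true_and, edgeNth, dif_pos h]
    rw [← Finset.mem_coe, ← Finset.range_orderEmbOfFin X h]
    rfl

theorem eq_edgeNth {V : Type*} [LinearOrder V] [Nonempty V] (hr : 2 ≤ r) {h : Fin r → V}
    (hh : StrictMono h ∨ ∀ i j, h i = h j) : h = edgeNth r (Finset.univ.image h) := by
  rcases hh with hh | hh
  · have hc : (Finset.univ.image h).card = r := by
      rw [Finset.card_image_of_injective _ hh.injective, Finset.card_fin]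
    funext i
    simp only [edgeNth, dif_pos hc]
    exact congrFun (Finset.orderEmbOfFin_unique hc (fun x => by simp) hh) i
  · have : Nonempty (Fin r) := ⟨⟨0, by omega⟩⟩
    funext i
    have hi : Finset.univ.image h = {h i} := by
      ext z
      simp [hh _ i, eq_comm]
    rw [hi, edgeNth_singleton hr]

/-- Strong rigid quotient maps commute with the enumeration of edges. -/
theorem IsSRQhgr.apply_edgeNth (hr : 2 ≤ r) {M N : OHgrObj r} [Nonempty M.carrier]
    [Nonempty N.carrier] {g : M.carrier → N.carrier} (hg : IsSRQhgr M N g)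
    {e : Finset M.carrier} (he : e ∈ M.edges) (i : Fin r) :
    g (edgeNth r e i) = edgeNth r (e.image g) i := by
  have himg := image_edgeNth hr (M.card_mem e he)
  have hmem : ∀ i, edgeNth r e i ∈ e := fun i => by
    have := Finset.mem_image_of_mem (edgeNth r e) (Finset.mem_univ i)
    rwa [himg] at this
  have key := eq_edgeNth hr (h := fun i => g (edgeNth r e i)) ?_
  · have himg' : Finset.univ.image (fun i => g (edgeNth r e i)) = e.image g := by
      conv_rhs => rw [← himg, Finset.image_image]
      rfl
    rw [himg'] at key
    exact congrFun key i
  · by_cases hc : ∀ x ∈ e, ∀ y ∈ e, g x = g y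
    · exact Or.inr fun i j => hc _ (hmem i) _ (hmem j)
    · rcases M.card_mem e he with h1 | h1
      · obtain ⟨v, rfl⟩ := Finset.card_eq_one.1 h1
        simp at hc
      · exact Or.inl fun i j hij => hg.2.2 e he hc _ (hmem i) _ (hmem j)
          (strictMono_edgeNth h1 hij)

/-- A rigid enumeration of the edges of `B` by a finite chain `L` induces a strong rigid
quotient map `r ⊠ L → B`. -/
theorem isSRQhgr_edgeNth (hr : 2 ≤ r) {n : ℕ} {M B : OHgrObj r} [Nonempty B.carrier]
    (e : M.carrier ≃o Lex (Fin n × Fin r))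
    (he : ∀ E : Finset M.carrier, E ∈ M.edges ↔ E.image ⇑e ∈ rBoxRel r (Fin n))
    (ψ : Fin n → Finset B.carrier) (hψ : ∀ l, ψ l ∈ B.edges)
    (hsurj : ∀ x ∈ B.edges, ∃ l, ψ l = x)
    (hrig : ∀ l, ∀ x ∈ B.edges, finsetSalLT x (ψ l) → ∃ l' < l, ψ l' = x) :
    IsSRQhgr M B fun c => edgeNth r (ψ (ofLex (e c)).1) (ofLex (e c)).2 := by
  set w : M.carrier → B.carrier := fun c => edgeNth r (ψ (ofLex (e c)).1) (ofLex (e c)).2 with hw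
  let vert : Fin n → Fin r → M.carrier := fun l i => e.symm (toLex (l, i))
  let box : Fin n → Finset M.carrier := fun l => Finset.univ.image (vert l)
  have he_vert : ∀ l i, e (vert l i) = toLex (l, i) := fun l i => e.apply_symm_apply _
  have hw_vert : ∀ l i, w (vert l i) = edgeNth r (ψ l) i := by
    intro l i
    simp [hw, he_vert]
  have vert_surj : ∀ c, ∃ l i, c = vert l i := fun c =>
    ⟨(ofLex (e c)).1, (ofLex (e c)).2, by simp [vert]⟩
  have vert_lt : ∀ l i l' i', vert l i < vert l' i' ↔ l < l' ∨ l = l' ∧ i < i' := by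
    intro l i l' i'
    simp [vert, Prod.Lex.toLex_lt_toLex]
  have himage : ∀ l, (box l).image w = ψ l := by
    intro l
    rw [Finset.image_image]
    have : w ∘ vert l = edgeNth r (ψ l) := funext fun i => hw_vert l i
    rw [this]
    exact image_edgeNth hr (B.card_mem _ (hψ l))
  have hbox : ∀ l, box l ∈ M.edges := by
    intro l
    refine (he _).2 (Or.inr ⟨l, ?_⟩)
    rw [Finset.image_image]
    congr 1
    exact funext fun i => he_vert l i
  have hedges : ∀ E ∈ M.edges, (∃ c, E = {c}) ∨ ∃ l, E = box l := by
    intro E hE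
    rcases (he E).1 hE with ⟨a, ha⟩ | ⟨l, hl⟩
    · refine Or.inl ⟨e.symm a, Finset.image_injective e.injective ?_⟩
      rw [ha]
      simp
    · refine Or.inr ⟨l, Finset.image_injective e.injective ?_⟩
      rw [hl, Finset.image_image]
      congr 1
      exact funext fun i => (he_vert l i).symm
  have hhom : ∀ E ∈ M.edges, E.image w ∈ B.edges := by
    intro E hE
    rcases hedges E hE with ⟨c, rfl⟩ | ⟨l, rfl⟩
    · rw [Finset.image_singleton]
      exact B.singleton_mem _
    · rw [himage]
      exact hψ l
  have hcard : ∀ l, (box l).card = r := by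
    intro l
    rw [Finset.card_image_of_injective, Finset.card_fin]
    intro i j hij
    simpa [vert] using hij
  have vert_mem : ∀ l i l', vert l i ∈ box l' ↔ l = l' := by
    intro l i l'
    simp only [box, Finset.mem_image, Finset.mem_univ, true_and]
    constructor
    · rintro ⟨j, hj⟩
      have : l' = l ∧ j = i := by simpa [vert] using hj
      exact this.1.symm
    · rintro rfl
      exact ⟨i, rfl⟩
  have hbox_lt : ∀ l l', l < l' → finsetSalLT (box l) (box l') := by
    intro l l' hl
    refine Or.inr (Or.inr (Or.inr ⟨by rw [hcard]; omega, by rw [hcard]; omega, ?_⟩))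
    refine ⟨vert l' ⟨r - 1, by omega⟩, (vert_mem _ _ _).2 rfl,
      fun h => hl.ne' ((vert_mem _ _ _).1 h), fun z hz => ?_⟩
    obtain ⟨m, i, rfl⟩ := vert_surj z
    rw [vert_mem, vert_mem]
    have hm : l' < m := by
      rcases (vert_lt _ _ _ _).1 hz with h | ⟨-, h⟩
      · exact h
      · have := Fin.lt_def.1 h
        simp only at this
        omega
    exact ⟨fun h => absurd (hm.trans_le h.le) (not_lt.2 hl.le), fun h => absurd h hm.ne'⟩
  have hback : ∀ E ∈ M.edges, ∀ x ∈ B.edges, finsetSalLT x (E.image w) →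
      ∃ E' ∈ M.edges, finsetSalLT E' E ∧ E'.image w = x := by
    intro E hE x hx hlt
    rcases hedges E hE with ⟨c, rfl⟩ | ⟨l, rfl⟩
    · obtain ⟨l, i, rfl⟩ := vert_surj c
      rw [Finset.image_singleton] at hlt
      obtain ⟨v, rfl, hv⟩ : ∃ v, x = {v} ∧ v < w (vert l i) := by
        rcases hlt with ⟨h, -⟩ | ⟨a, b, h1, h2, h3⟩ | ⟨-, h⟩ | ⟨-, h, -⟩
        · exact absurd h (B.nonempty_of_mem_edges hr hx).ne_empty
        · exact ⟨a, h1, by rw [Finset.singleton_injective h2]; exact h3⟩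
        · simp at h
        · simp at h
      have hlt' : finsetSalLT {v} (ψ l) := by
        rcases B.card_mem _ (hψ l) with h1 | h1
        · obtain ⟨u, hu⟩ := Finset.card_eq_one.1 h1
          rw [hw_vert, hu, edgeNth_singleton hr] at hv
          exact Or.inr (Or.inl ⟨v, u, rfl, hu, hv⟩)
        · exact Or.inr (Or.inr (Or.inl ⟨⟨v, rfl⟩, by omega⟩))
      obtain ⟨l', hl', hl'v⟩ := hrig l _ hx hlt'
      refine ⟨{vert l' i}, M.singleton_mem _, Or.inr (Or.inl ⟨_, _, rfl, rfl, ?_⟩), ?_⟩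
      · exact (vert_lt _ _ _ _).2 (Or.inl hl')
      · rw [Finset.image_singleton, hw_vert, hl'v, edgeNth_singleton hr]
    · rw [himage] at hlt
      obtain ⟨l', hl', rfl⟩ := hrig l _ hx hlt
      exact ⟨box l', hbox l', hbox_lt _ _ hl', himage l'⟩
  refine ⟨hhom, ⟨hhom, ?_, ?_⟩, ?_⟩
  · intro x hx
    obtain ⟨l, rfl⟩ := hsurj x hx
    exact ⟨box l, hbox l, himage l⟩
  · intro x hx y hy hxy a b ha hb
    obtain ⟨b', hb', hlt, hbx⟩ := hback b hb.1.1 x hx (by rw [show b.image w = y from hb.1.2]; exact hxy)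
    rcases ha.2 b' ⟨hb', hbx⟩ with rfl | hab
    · exact hlt
    · have hne : ∀ {u}, u ∈ M.edges → u.Nonempty := M.nonempty_of_mem_edges hr
      rw [finsetSalLT_iff (hne ha.1.1) (hne hb')] at hab
      rw [finsetSalLT_iff (hne hb') (hne hb.1.1)] at hlt
      exact (finsetSalLT_iff (hne ha.1.1) (hne hb.1.1)).2 (hab.trans hlt)
  · intro E hE hc x hx y hy hxy
    rcases hedges E hE with ⟨c, rfl⟩ | ⟨l, rfl⟩
    · simp at hc
    · obtain ⟨l₁, i, rfl⟩ := vert_surj x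
      obtain ⟨l₂, j, rfl⟩ := vert_surj y
      obtain rfl := (vert_mem _ _ _).1 hx
      obtain rfl := (vert_mem _ _ _).1 hy
      rw [hw_vert, hw_vert]
      have hij : i < j := by simpa [vert_lt] using hxy
      rcases B.card_mem _ (hψ l₂) with h1 | h1
      · refine absurd (fun x hx y hy => ?_) hc
        obtain ⟨u, hu⟩ := Finset.card_eq_one.1 h1
        have key : ∀ z ∈ box l₂, w z = u := by
          intro z hz
          have := Finset.mem_image_of_mem w hz
          rw [himage, hu] at this
          exact Finset.mem_singleton.1 this
        rw [key x hx, key y hy]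
      · exact strictMono_edgeNth h1 hij

/-- A class of hypergraphs containing a copy of `r ⊠ L` for every finite chain `L` has the dual
Ramsey property with respect to strong rigid quotient maps. -/
theorem hasDualRamseySub_of_rBox (hr : 2 ≤ r) (S : Set (OHgrObj r))
    (hS : ∀ n : ℕ, ∃ M ∈ S, ∃ e : M.carrier ≃o Lex (Fin n × Fin r),
      ∀ E : Finset M.carrier, E ∈ M.edges ↔ E.image ⇑e ∈ rBoxRel r (Fin n)) :
    HasDualRamseySub (fun M : OHgrObj r => M.carrier) IsSRQhgr S := by
  rintro k hk A - B - ⟨g₀, hg₀⟩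
  have : Nonempty (Fin k) := ⟨⟨0, by omega⟩⟩
  rcases isEmpty_or_nonempty A.carrier with hA | hA
  · have hB : IsEmpty B.carrier := ⟨fun b => hA.elim (g₀ b)⟩
    obtain ⟨C, hC, e, -⟩ := hS 0
    have hCe : IsEmpty C.carrier := ⟨fun c => (ofLex (e c)).1.elim0⟩
    have hedge : ∀ (M : OHgrObj r), IsEmpty M.carrier → ∀ E ∈ M.edges, False := by
      intro M hM E hE
      obtain ⟨x, -⟩ := M.nonempty_of_mem_edges hr hE
      exact hM.elim x
    refine ⟨C, hC, fun χ => ⟨fun c => hCe.elim c, ⟨fun E hE => (hedge C hCe E hE).elim,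
      ⟨fun E hE => (hedge C hCe E hE).elim, fun E hE => (hedge B hB E hE).elim,
        fun E hE => (hedge B hB E hE).elim⟩, fun E hE => (hedge C hCe E hE).elim⟩,
      χ fun c => hCe.elim c, fun g _ => ?_⟩⟩
    congr 1
    exact funext fun c => hCe.elim c
  have hB : Nonempty B.carrier := by
    obtain ⟨a⟩ := hA
    obtain ⟨e, he, -⟩ := hg₀.2.1.2.1 {a} (A.singleton_mem a)
    exact ⟨(B.nonempty_of_mem_edges hr he).choose⟩
  obtain ⟨p, εA, hεA⟩ := A.exists_edge_enumeration hr
  obtain ⟨q, εB, hεB⟩ := B.exists_edge_enumeration hr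
  obtain ⟨n, hn⟩ := exists_paramWord_mono p 0 q (Fin k)
  obtain ⟨C, hC, e, he⟩ := hS n
  refine ⟨C, hC, fun χ => ?_⟩
  let decode : ℕ → Finset A.carrier := fun x => if h : x < p then (εA ⟨x, h⟩).1 else ∅
  obtain ⟨f, hfn, hf, c, hc⟩ := hn fun u =>
    χ fun v => edgeNth r (decode (u.getD (ofLex (e v)).1 0)) (ofLex (e v)).2
  rw [zero_add] at hf
  have hlt : ∀ l : Fin n, f[l] < q := fun l => hf.lt_of_mem _ (List.getElem_mem _)
  let ψ : Fin n → Finset B.carrier := fun l => (εB ⟨f[l], hlt l⟩).1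
  have hψ : ∀ l, ψ l ∈ B.edges := fun l => (εB ⟨f[l], hlt l⟩).2
  refine ⟨_, isSRQhgr_edgeNth hr e he ψ hψ ?_ ?_, c, fun g hg => ?_⟩
  · intro x hx
    obtain ⟨l, hl, hlx⟩ := List.getElem_of_mem
      (hf.mem_of_le_of_lt (εB.symm ⟨x, hx⟩) (Nat.zero_le _) (Fin.is_lt _))
    refine ⟨⟨l, by omega⟩, ?_⟩
    simp [ψ, hlx]
  · intro l x hx hxl
    have h1 := (hεB (εB.symm ⟨x, hx⟩) ⟨f[l], hlt l⟩).1 (by rw [Equiv.apply_symm_apply]; exact hxl)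
    obtain ⟨j, hj, hjx⟩ := hf.exists_lt_getElem l (by omega) (εB.symm ⟨x, hx⟩)
      (Nat.zero_le _) h1
    refine ⟨⟨j, by omega⟩, hj, ?_⟩
    simp [ψ, hjx]
  · have hu := hg.paramWord hr εA εB hεA hεB
    rw [← hc _ (by rw [zero_add]; exact hu) (by simp)]
    congr 1
    funext v
    have hl : (((ofLex (e v)).1 : Fin n) : ℕ) < f.length := by omega
    simp only [Function.comp]
    rw [hg.apply_edgeNth hr (hψ _)]
    congr 1
    rw [List.getD_eq_getElem _ _ (by simpa using hl), getElem_substWord _ _ _ hl,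
      if_neg (Nat.not_lt_zero _), Nat.sub_zero, List.getD_eq_getElem _ _ (by
        simpa using hlt (ofLex (e v)).1)]
    simp [decode, ψ]

end Transfer

/-- The hypergraph `r ⊠ L`. -/
def rBox (r : ℕ) (L : Type) [Fintype L] [LinearOrder L] : OHgrObj r where
  carrier := Lex (L × Fin r)
  fintypeI := inferInstanceAs (Fintype (L × Fin r))
  edges := rBoxRel r L
  singleton_mem x := Or.inl ⟨x, rfl⟩
  card_mem := by
    rintro e (⟨a, rfl⟩ | ⟨x, rfl⟩)
    · exact Or.inl (Finset.card_singleton a)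
    · right
      rw [Finset.card_image_of_injective, Finset.card_fin]
      intro i j h
      simpa using h

theorem hasDualRamseySub_of_rBox_mem {r : ℕ} (hr : 2 ≤ r) (S : Set (OHgrObj r))
    (hS : ∀ n : ℕ, rBox r (Fin n) ∈ S) :
    HasDualRamseySub (fun M : OHgrObj r => M.carrier) IsSRQhgr S :=
  hasDualRamseySub_of_rBox hr S fun n =>
    ⟨rBox r (Fin n), hS n, OrderIso.refl _, fun E => by
      have : E.image (OrderIso.refl (Lex (Fin n × Fin r))) = E := Finset.image_id
      exact (iff_of_eq (congrArg (· ∈ rBoxRel r (Fin n)) this)).symm⟩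

/-- Cliques in `r ⊠ L` have at most `r` vertices. -/
theorem card_le_of_clique_rBoxRel {r : ℕ} {L : Type} [LinearOrder L]
    {T : Finset (Lex (L × Fin r))}
    (hT : ∀ x ∈ T, ∀ y ∈ T, x ≠ y → ∃ E ∈ rBoxRel r L, x ∈ E ∧ y ∈ E) : T.card ≤ r := by
  have hinj : Set.InjOn (fun x : Lex (L × Fin r) => (ofLex x).2) T := by
    intro x hx y hy hxy
    by_contra hne
    obtain ⟨E, ⟨a, rfl⟩ | ⟨l, rfl⟩, hxE, hyE⟩ := hT x hx y hy hne
    · exact hne ((Finset.mem_singleton.1 hxE).trans (Finset.mem_singleton.1 hyE).symm)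
    · obtain ⟨i, -, rfl⟩ := Finset.mem_image.1 hxE
      obtain ⟨j, -, rfl⟩ := Finset.mem_image.1 hyE
      exact hne (congrArg (fun i => toLex (l, i)) hxy)
  simpa using Finset.card_le_card_of_injOn (t := (Finset.univ : Finset (Fin r))) _
    (fun x _ => Finset.mem_univ _) hinj

/-- Corollary 5.8. Let `r ≥ 2`. Every full subcategory `C` of
`OHgr_srq(r)` such that for every finite chain `L` there is an object of `C`
isomorphic to `r ⊠ L` has the dual Ramsey property. In particular, the categories
`OHgr_srq(r)` (`r ≥ 2`), `OGra_srq = OHgr_srq(2)`, the full subcategory of `OGra_srq`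
spanned by bipartite graphs, and the full subcategory of `OGra_srq` spanned by
`K_n`-free graphs (`n ≥ 3` fixed), all have the dual Ramsey property. -/
theorem stmt15 :
    (∀ r : ℕ, 2 ≤ r → ∀ S : Set (OHgrObj r),
      (∀ (L : Type) [Fintype L] [LinearOrder L],
        ∃ M ∈ S, ∃ e : M.carrier ≃o Lex (L × Fin r),
          ∀ E : Finset M.carrier, E ∈ M.edges ↔ E.image ⇑e ∈ rBoxRel r L) →
      HasDualRamseySub (fun M : OHgrObj r => M.carrier) IsSRQhgr S)
    ∧ (∀ r : ℕ, 2 ≤ r →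
        HasDualRamseyClass (fun M : OHgrObj r => M.carrier) IsSRQhgr)
    ∧ HasDualRamseyClass (fun M : OHgrObj 2 => M.carrier) IsSRQhgr
    ∧ HasDualRamseySub (fun M : OHgrObj 2 => M.carrier) IsSRQhgr
        {M : OHgrObj 2 | ∃ P : M.carrier → Bool,
          ∀ e ∈ M.edges, e.card = 2 → ∃ x ∈ e, ∃ y ∈ e, P x ≠ P y}
    ∧ ∀ n : ℕ, 3 ≤ n → HasDualRamseySub (fun M : OHgrObj 2 => M.carrier) IsSRQhgr
        {M : OHgrObj 2 | ∀ T : Finset M.carrier,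
          (∀ x ∈ T, ∀ y ∈ T, x ≠ y → ({x, y} : Finset M.carrier) ∈ M.edges) →
          T.card < n} := by
  refine ⟨fun r hr S hS => hasDualRamseySub_of_rBox hr S fun n => hS (Fin n),
    fun r hr => hasDualRamseySub_of_rBox_mem hr _ fun _ => Set.mem_univ _,
    hasDualRamseySub_of_rBox_mem le_rfl _ fun _ => Set.mem_univ _,
    hasDualRamseySub_of_rBox_mem le_rfl _ fun n => ?_,
    fun n hn => hasDualRamseySub_of_rBox_mem le_rfl _ fun m T hT => ?_⟩
  · refine ⟨fun x => decide (Prod.snd (ofLex (α := Fin n × Fin 2) x) = 0), ?_⟩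
    rintro e (⟨a, rfl⟩ | ⟨l, rfl⟩) he
    · exact absurd ((Finset.card_singleton a).symm.trans he) (by norm_num)
    · refine ⟨toLex (l, 0), Finset.mem_image_of_mem _ (Finset.mem_univ _), toLex (l, 1),
        Finset.mem_image_of_mem _ (Finset.mem_univ _), ?_⟩
      change decide ((0 : Fin 2) = 0) ≠ decide ((1 : Fin 2) = 0)
      simp
  · exact lt_of_le_of_lt (card_le_of_clique_rBoxRel (r := 2) (L := Fin m) (T := T)
      fun x hx y hy hxy => ⟨_, hT x hx y hy hxy, Finset.mem_insert_self _ _,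
        Finset.mem_insert_of_mem (Finset.mem_singleton_self _)⟩) hn
end
end
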